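/- Let λ ∈ ℂ^r be dominant, μ ∈ S(λ;ℓ), and let L be a simple quotient of the H_ℓ-module K(λ,μ). If μ ∈ S^{(n)}(λ;ℓ), then D_ℓ(L) is a nonzero simple Y(gl_n)-module and the quotient map K(λ,μ) ↠ L induces a surjection of Y(gl_n)-modules D_ℓ(K(λ,μ)) ↠ D_ℓ(L); if μ ∉ S^{(n)}(λ;ℓ), then D_ℓ(L) = 0. -/

import Mathlib

set_option synthInstance.maxHeartbeats 1000000
set_option maxHeartbeats 1000000

noncomputable section

open scoped TensorProduct

/-- Generators of the degenerate affine Hecke algebra `H_ℓ`: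
the group elements `w ∈ W_ℓ` and the polynomial generators `ε_i`. -/
inductive HGen (ℓ : ℕ) : Type
  | perm : Equiv.Perm (Fin ℓ) → HGen ℓ
  | eps : Fin ℓ → HGen ℓ

/-- Defining relations of the degenerate affine Hecke algebra: `ℂ[W_ℓ]` is a subalgebra,
`ℂ[ε_1,…,ε_ℓ]` is a (commutative polynomial) subalgebra, and the cross relation
`s_i ε_j − ε_{s_i(j)} s_i = −(δ_{i,j} − δ_{i+1,j})`. -/
inductive HRel (ℓ : ℕ) : FreeAlgebra ℂ (HGen ℓ) → FreeAlgebra ℂ (HGen ℓ) → Prop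
  | permMul (w w' : Equiv.Perm (Fin ℓ)) :
      HRel ℓ (FreeAlgebra.ι ℂ (HGen.perm w) * FreeAlgebra.ι ℂ (HGen.perm w'))
        (FreeAlgebra.ι ℂ (HGen.perm (w * w')))
  | permOne :
      HRel ℓ (FreeAlgebra.ι ℂ (HGen.perm 1)) 1
  | epsComm (i j : Fin ℓ) :
      HRel ℓ (FreeAlgebra.ι ℂ (HGen.eps i) * FreeAlgebra.ι ℂ (HGen.eps j))
        (FreeAlgebra.ι ℂ (HGen.eps j) * FreeAlgebra.ι ℂ (HGen.eps i))
  | cross (i j : Fin ℓ) (h : (i : ℕ) + 1 < ℓ) :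
      HRel ℓ
        (FreeAlgebra.ι ℂ (HGen.perm (Equiv.swap i ⟨(i : ℕ) + 1, h⟩)) *
            FreeAlgebra.ι ℂ (HGen.eps j) -
          FreeAlgebra.ι ℂ (HGen.eps (Equiv.swap i ⟨(i : ℕ) + 1, h⟩ j)) *
            FreeAlgebra.ι ℂ (HGen.perm (Equiv.swap i ⟨(i : ℕ) + 1, h⟩)))
        ((-(((if j = i then 1 else 0) : ℂ) - (if j = ⟨(i : ℕ) + 1, h⟩ then 1 else 0))) • 1)

/-- The degenerate affine Hecke algebra `H_ℓ`, as the algebra presented by the above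
generators and relations. -/
abbrev Hecke (ℓ : ℕ) : Type := RingQuot (HRel ℓ)

/-- The image of `w ∈ W_ℓ` in `H_ℓ`. -/
def Hecke.sigma {ℓ : ℕ} (w : Equiv.Perm (Fin ℓ)) : Hecke ℓ :=
  RingQuot.mkAlgHom ℂ (HRel ℓ) (FreeAlgebra.ι ℂ (HGen.perm w))

/-- The image of `ε_i` in `H_ℓ`. -/
def Hecke.eps {ℓ : ℕ} (i : Fin ℓ) : Hecke ℓ :=
  RingQuot.mkAlgHom ℂ (HRel ℓ) (FreeAlgebra.ι ℂ (HGen.eps i))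

/-- The elements `y_m := ε_m − Σ_{j<m} s_{jm}` of `H_ℓ`. -/
def Hecke.y {ℓ : ℕ} (m : Fin ℓ) : Hecke ℓ :=
  Hecke.eps m - ∑ j ∈ Finset.univ.filter (fun j : Fin ℓ => j < m), Hecke.sigma (Equiv.swap j m)

/-- Index type for the Yangian generators `t_{ij}^{(d)}`. -/
def tIdx (n : ℕ) : Type := Fin n × Fin n × ℕ

/-- `t_{ij}^{(d)}` in the free algebra, for `d : ℤ`, with the convention
`t_{ij}^{(-1)} = δ_{ij}·1` (and junk value `0` for `d ≤ -2`, which never occurs). -/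
def tFree {n : ℕ} (i j : Fin n) (d : ℤ) : FreeAlgebra ℂ (tIdx n) :=
  if d = -1 then (if i = j then 1 else 0)
  else if 0 ≤ d then FreeAlgebra.ι ℂ ((i, j, d.toNat) : tIdx n) else 0

/-- Defining relations of the Yangian `Y(gl_n)`:
`[t_{ij}^{(r)}, t_{kl}^{(s−1)}] − [t_{ij}^{(r−1)}, t_{kl}^{(s)}]
  = t_{kj}^{(r−1)} t_{il}^{(s−1)} − t_{kj}^{(s−1)} t_{il}^{(r−1)}`. -/
inductive YRel (n : ℕ) : FreeAlgebra ℂ (tIdx n) → FreeAlgebra ℂ (tIdx n) → Prop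
  | rel (i j k l : Fin n) (r s : ℕ) :
      YRel n
        (tFree i j (r : ℤ) * tFree k l ((s : ℤ) - 1) - tFree k l ((s : ℤ) - 1) * tFree i j (r : ℤ)
          - (tFree i j ((r : ℤ) - 1) * tFree k l (s : ℤ)
              - tFree k l (s : ℤ) * tFree i j ((r : ℤ) - 1)))
        (tFree k j ((r : ℤ) - 1) * tFree i l ((s : ℤ) - 1) -
          tFree k j ((s : ℤ) - 1) * tFree i l ((r : ℤ) - 1))

/-- The Yangian `Y(gl_n)`. -/
abbrev Yangian (n : ℕ) : Type := RingQuot (YRel n)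

/-- The generator `t_{ij}^{(d)}`, `d ≥ 0`, of the Yangian. -/
def Yangian.t {n : ℕ} (i j : Fin n) (d : ℕ) : Yangian n :=
  RingQuot.mkAlgHom ℂ (YRel n) (FreeAlgebra.ι ℂ ((i, j, d) : tIdx n))

/-! ## The Drinfeld functor -/

/-- Words of length `ℓ` in the alphabet `{1,…,n}`: the standard basis of `(ℂ^n)^{⊗ℓ}`
is indexed by such words. -/
abbrev Word (ℓ n : ℕ) : Type := Fin ℓ → Fin n

/-- Concrete model for `M ⊗ (ℂ^n)^{⊗ℓ}`: functions from words to `M`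
(the value at a word is the coefficient of the corresponding basis vector). -/
abbrev MW (ℓ n : ℕ) (M : Type) : Type := Word ℓ n → M

section Dfun

variable {ℓ n : ℕ} {M : Type} [AddCommGroup M] [Module ℂ M]

/-- The operator `P_σ` permuting the tensor factors of `(ℂ^n)^{⊗ℓ}`. -/
def permOp (n : ℕ) {ℓ : ℕ} {M : Type} [AddCommGroup M] [Module ℂ M]
    (σ : Equiv.Perm (Fin ℓ)) : MW ℓ n M →ₗ[ℂ] MW ℓ n M where
  toFun f := fun w => f (w ∘ σ)
  map_add' _ _ := rfl
  map_smul' _ _ := rfl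

/-- The operator `τ_m(E_{ab})`, acting as the matrix unit `E_{ab}` on the `m`-th
tensor factor of `(ℂ^n)^{⊗ℓ}` and as the identity elsewhere. -/
def tauOp {ℓ n : ℕ} {M : Type} [AddCommGroup M] [Module ℂ M]
    (m : Fin ℓ) (a b : Fin n) : MW ℓ n M →ₗ[ℂ] MW ℓ n M where
  toFun f := fun w => if w m = a then f (Function.update w m b) else 0
  map_add' f g := by funext w; by_cases h : w m = a <;> simp [h]
  map_smul' c f := by funext w; by_cases h : w m = a <;> simp [h]

/-- The action of `h ∈ H_ℓ` on the coefficients (i.e. on the factor `M`). -/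
def hOp (n : ℕ) {ℓ : ℕ} {M : Type} [AddCommGroup M] [Module ℂ M]
    (ρ : Hecke ℓ →ₐ[ℂ] Module.End ℂ M) (h : Hecke ℓ) : MW ℓ n M →ₗ[ℂ] MW ℓ n M :=
  (ρ h).compLeft (Word ℓ n)

/-- The action of the transposition `s_{ij} ∈ W_ℓ` on `M ⊗ (ℂ^n)^{⊗ℓ}`, namely
`K_{ij} P_{ij}`. -/
def sOp (n : ℕ) {ℓ : ℕ} {M : Type} [AddCommGroup M] [Module ℂ M]
    (ρ : Hecke ℓ →ₐ[ℂ] Module.End ℂ M) (i j : Fin ℓ) : MW ℓ n M →ₗ[ℂ] MW ℓ n M :=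
  hOp n ρ (Hecke.sigma (Equiv.swap i j)) ∘ₗ permOp n (Equiv.swap i j)

/-- The subspace `N(M) = Σ_{i=1}^{ℓ-1} Im(s_i + 1)` of `M ⊗ (ℂ^n)^{⊗ℓ}`. -/
def NSub (n : ℕ) {ℓ : ℕ} {M : Type} [AddCommGroup M] [Module ℂ M]
    (ρ : Hecke ℓ →ₐ[ℂ] Module.End ℂ M) : Submodule ℂ (MW ℓ n M) :=
  ⨆ (i : Fin ℓ) (h : (i : ℕ) + 1 < ℓ),
    LinearMap.range (sOp n ρ i ⟨(i : ℕ) + 1, h⟩ + LinearMap.id)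

/-- The Drinfeld functor: `D_ℓ(M) = (M ⊗ (ℂ^n)^{⊗ℓ})/N(M)`. -/
abbrev Dmod (n : ℕ) {ℓ : ℕ} {M : Type} [AddCommGroup M] [Module ℂ M]
    (ρ : Hecke ℓ →ₐ[ℂ] Module.End ℂ M) : Type :=
  MW ℓ n M ⧸ NSub n ρ

/-- The operator `Σ_{m=1}^{ℓ} y_m^d ⊗ τ_m(E_{ab})` on `M ⊗ (ℂ^n)^{⊗ℓ}`. -/
def sumOp (n : ℕ) {ℓ : ℕ} {M : Type} [AddCommGroup M] [Module ℂ M]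
    (ρ : Hecke ℓ →ₐ[ℂ] Module.End ℂ M) (a b : Fin n) (d : ℕ) :
    MW ℓ n M →ₗ[ℂ] MW ℓ n M :=
  ∑ m : Fin ℓ, hOp n ρ ((Hecke.y m) ^ d) ∘ₗ tauOp m a b

/-- `π` is the Yangian action on `D_ℓ(M)` provided by Propositions 2.1 and 2.4 of
the paper: `t_{ab}^{(d)}` acts by the endomorphism induced by
`Σ_{m=1}^{ℓ} y_m^d ⊗ τ_m(E_{ab})`. -/
def IsDrinfeldAction (n : ℕ) {ℓ : ℕ} {M : Type} [AddCommGroup M] [Module ℂ M]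
    (ρ : Hecke ℓ →ₐ[ℂ] Module.End ℂ M)
    (π : Yangian n →ₐ[ℂ] Module.End ℂ (Dmod n ρ)) : Prop :=
  ∀ (a b : Fin n) (d : ℕ) (f : MW ℓ n M),
    π (Yangian.t a b d) (Submodule.Quotient.mk f) = Submodule.Quotient.mk (sumOp n ρ a b d f)

/-- A subspace stable under a Yangian action: a `Y(gl_n)`-submodule. -/
def YStable {n : ℕ} {V : Type} [AddCommGroup V] [Module ℂ V]
    (π : Yangian n →ₐ[ℂ] Module.End ℂ V) (q : Submodule ℂ V) : Prop :=
  ∀ (y : Yangian n) (x : V), x ∈ q → π y x ∈ q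

/-- A nonzero `Y(gl_n)`-module with no proper nonzero submodule: a simple module. -/
def YSimple {n : ℕ} {V : Type} [AddCommGroup V] [Module ℂ V]
    (π : Yangian n →ₐ[ℂ] Module.End ℂ V) : Prop :=
  Nontrivial V ∧ ∀ q : Submodule ℂ V, YStable π q → q = ⊥ ∨ q = ⊤

/-- A subspace stable under an `H_ℓ`-action: an `H_ℓ`-submodule. -/
def HStable {ℓ : ℕ} {M : Type} [AddCommGroup M] [Module ℂ M]
    (ρ : Hecke ℓ →ₐ[ℂ] Module.End ℂ M) (p : Submodule ℂ M) : Prop :=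
  ∀ (h : Hecke ℓ) (x : M), x ∈ p → ρ h x ∈ p

/-- A nonzero `H_ℓ`-module with no proper nonzero submodule: a simple module. -/
def HSimple {ℓ : ℕ} {M : Type} [AddCommGroup M] [Module ℂ M]
    (ρ : Hecke ℓ →ₐ[ℂ] Module.End ℂ M) : Prop :=
  Nontrivial M ∧ ∀ p : Submodule ℂ M, HStable ρ p → p = ⊥ ∨ p = ⊤

end Dfun

/-! ## Standard modules `K(λ,μ)` -/

section Standard

variable {r : ℕ}

/-- The offset `Σ_{j<k} ℓ_j` of the `k`-th block. -/
def off {r : ℕ} (L : Fin r → ℕ) (k : Fin r) : ℕ :=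
  ∑ j ∈ Finset.univ.filter (fun j : Fin r => j < k), L j

/-- `m ∈ {1,…,ℓ}` belongs to the `k`-th block of sizes `L = (ℓ_1,…,ℓ_r)`. -/
def inBlock {r : ℕ} (L : Fin r → ℕ) (k : Fin r) (m : ℕ) : Prop :=
  off L k ≤ m ∧ m < off L k + L k

/-- The left ideal of `H_ℓ` by which one quotients to obtain the standard module
`K(λ,μ) = H_ℓ ⊗_{H_{ℓ_1} ⊗ ⋯ ⊗ H_{ℓ_r}} (ℂ_{[μ_1,λ_1−1]} ⊗ ⋯ ⊗ ℂ_{[μ_r,λ_r−1]})`: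
it is generated by `ε_m − (μ_k + (m − off k))` for `m` in the `k`-th block, and by
`s_m − 1` for `m, m+1` in the same block. -/
def KIdeal (ℓ : ℕ) {r : ℕ} (L : Fin r → ℕ) (μ : Fin r → ℂ) :
    Submodule (Hecke ℓ) (Hecke ℓ) :=
  Submodule.span (Hecke ℓ)
    ({x | ∃ (m : Fin ℓ) (k : Fin r), inBlock L k (m : ℕ) ∧
        x = Hecke.eps m - (μ k + (((m : ℕ) - off L k : ℕ) : ℂ)) • 1} ∪
      {x | ∃ (m m' : Fin ℓ) (k : Fin r), (m' : ℕ) = (m : ℕ) + 1 ∧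
        inBlock L k (m : ℕ) ∧ inBlock L k (m' : ℕ) ∧
        x = Hecke.sigma (Equiv.swap m m') - 1})

/-- The standard module `K(λ,μ)`, realized as the quotient of `H_ℓ` by the
left ideal `KIdeal`. -/
abbrev KMod (ℓ : ℕ) {r : ℕ} (L : Fin r → ℕ) (μ : Fin r → ℂ) : Type :=
  Hecke ℓ ⧸ KIdeal ℓ L μ

/-- The `H_ℓ`-action on a quotient of `H_ℓ` by a left ideal, as an algebra map to
endomorphisms. -/
def quotRho {ℓ : ℕ} (I : Submodule (Hecke ℓ) (Hecke ℓ)) :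
    Hecke ℓ →ₐ[ℂ] Module.End ℂ (Hecke ℓ ⧸ I) :=
  Algebra.lsmul ℂ ℂ (Hecke ℓ ⧸ I)

end Standard

/-- An action of the degenerate affine Hecke algebra in its `W`-equivariant presentation: a
representation `S` of the symmetric group, together with operators `Y` which are permuted by it
and satisfy `[Y_a, Y_b] = (Y_b - Y_a) s_{ab}`. -/
structure EquivariantAction (X M : Type) [DecidableEq X] [AddCommGroup M] [Module ℂ M] where
  S : Equiv.Perm X →* Module.End ℂ M
  Y : X → Module.End ℂ M
  equivariant : ∀ w m, S w * Y m = Y (w m) * S w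
  bracket : ∀ a b, a ≠ b → Y a * Y b - Y b * Y a = (Y b - Y a) * S (Equiv.swap a b)

namespace EquivariantAction

variable {X M : Type} [DecidableEq X] [AddCommGroup M] [Module ℂ M] (T : EquivariantAction X M)

/-- The transposition of `a` and `b` as an operator. -/
def s (a b : X) : Module.End ℂ M := T.S (Equiv.swap a b)

lemma s_symm (a b : X) : T.s a b = T.s b a := by
  rw [s, s, Equiv.swap_comm]

lemma s_self (a : X) (v : M) : T.s a a v = v := by
  rw [s, Equiv.swap_self]
  exact LinearMap.congr_fun T.S.map_one v

lemma s_s (a b : X) (v : M) : T.s a b (T.s a b v) = v := by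
  rw [s, ← Module.End.mul_apply, ← map_mul, Equiv.swap_mul_self, map_one, Module.End.one_apply]

lemma S_s (w : Equiv.Perm X) (a b : X) (v : M) :
    T.S w (T.s a b v) = T.s (w a) (w b) (T.S w v) := by
  rw [s, s, ← Module.End.mul_apply, ← map_mul, Equiv.mul_swap_eq_swap_mul, map_mul,
    Module.End.mul_apply]

lemma s_conj (a b c d : X) (v : M) :
    T.s a b (T.s c d v) = T.s (Equiv.swap a b c) (Equiv.swap a b d) (T.s a b v) :=
  T.S_s _ c d v

lemma s_comm {a b c d : X} (hca : c ≠ a) (hcb : c ≠ b) (hda : d ≠ a) (hdb : d ≠ b) (v : M) :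
    T.s a b (T.s c d v) = T.s c d (T.s a b v) := by
  rw [s_conj, Equiv.swap_apply_of_ne_of_ne hca hcb, Equiv.swap_apply_of_ne_of_ne hda hdb]

lemma S_Y (w : Equiv.Perm X) (m : X) (v : M) : T.S w (T.Y m v) = T.Y (w m) (T.S w v) := by
  rw [← Module.End.mul_apply, T.equivariant, Module.End.mul_apply]

/-- The operator `Y_m + ∑_{i ∈ P} s_{im}`, i.e. `ε_m` for an order in which `P` is the set of
predecessors of `m`. -/
def eta (m : X) (P : Finset X) : Module.End ℂ M := T.Y m + ∑ i ∈ P, T.s i m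

lemma eta_apply (m : X) (P : Finset X) (v : M) :
    T.eta m P v = T.Y m v + ∑ i ∈ P, T.s i m v := by
  simp [eta, LinearMap.sum_apply]

lemma S_mul_eta (w : Equiv.Perm X) (m : X) (P : Finset X) :
    T.S w * T.eta m P = T.eta (w m) (P.map w.toEmbedding) * T.S w := by
  ext v
  simp only [Module.End.mul_apply, eta_apply, map_add, map_sum, Finset.sum_map, S_s, S_Y]
  rfl

lemma S_eta (w : Equiv.Perm X) (m : X) (P : Finset X) (v : M) :
    T.S w (T.eta m P v) = T.eta (w m) (P.map w.toEmbedding) (T.S w v) :=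
  LinearMap.congr_fun (T.S_mul_eta w m P) v

lemma map_swap_of_notMem {a b : X} {P : Finset X} (ha : a ∉ P) (hb : b ∉ P) :
    P.map (Equiv.swap a b).toEmbedding = P := by
  have : ∀ x ∈ P, Equiv.swap a b x = x := fun x hx =>
    Equiv.swap_apply_of_ne_of_ne (fun h => ha (h ▸ hx)) (fun h => hb (h ▸ hx))
  ext x
  simp only [Finset.mem_map, Equiv.coe_toEmbedding]
  constructor
  · rintro ⟨y, hy, rfl⟩
    rwa [this y hy]
  · exact fun hx => ⟨x, hx, this x hx⟩

lemma map_swap_of_mem {a b : X} {P : Finset X} (ha : a ∈ P) (hb : b ∈ P) :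
    P.map (Equiv.swap a b).toEmbedding = P := by
  apply Finset.eq_of_subset_of_card_le
  · intro x
    simp only [Finset.mem_map, Equiv.coe_toEmbedding]
    rintro ⟨y, hy, rfl⟩
    rw [Equiv.swap_apply_def]
    split_ifs <;> assumption
  · simp

lemma eta_insert {m i : X} {P : Finset X} (hi : i ∉ P) :
    T.eta m (insert i P) = T.eta m P + T.s i m := by
  rw [eta, eta, Finset.sum_insert hi]
  abel

lemma swap_mul_eta {a b : X} {P : Finset X} (ha : a ∉ P) (hb : b ∉ P) :
    T.s a b * T.eta a P = T.eta b P * T.s a b := by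
  rw [s, S_mul_eta, Equiv.swap_apply_left, map_swap_of_notMem ha hb]

lemma eta_bracket {a b : X} (hab : a ≠ b) {P : Finset X} (ha : a ∉ P) (hb : b ∉ P) :
    T.eta a P * T.eta b P - T.eta b P * T.eta a P = (T.eta b P - T.eta a P) * T.s a b := by
  induction P using Finset.induction_on with
  | empty => simpa [eta, s] using T.bracket a b hab
  | insert i P hi ih =>
    have hai : a ≠ i := fun h => ha (by simp [h])
    have hbi : b ≠ i := fun h => hb (by simp [h])
    have ha' : a ∉ P := fun h => ha (by simp [h])
    have hb' : b ∉ P := fun h => hb (by simp [h])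
    have key := ih ha' hb'
    rw [eta_insert _ hi, eta_insert _ hi]
    have h1 : T.s i b * T.eta a P = T.eta a P * T.s i b := by
      rw [s, S_mul_eta, map_swap_of_notMem hi hb', Equiv.swap_apply_of_ne_of_ne hai hab]
    have h2 : T.s i a * T.eta b P = T.eta b P * T.s i a := by
      rw [s, S_mul_eta, map_swap_of_notMem hi ha', Equiv.swap_apply_of_ne_of_ne hbi hab.symm]
    have h3 : T.s i a * T.s i b = T.s i b * T.s a b := by
      ext v
      rw [Module.End.mul_apply, Module.End.mul_apply, s_conj T i b a b,
        Equiv.swap_apply_of_ne_of_ne hai hab, Equiv.swap_apply_right, s_symm T a i]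
    have h4 : T.s i b * T.s i a = T.s i a * T.s a b := by
      ext v
      rw [Module.End.mul_apply, Module.End.mul_apply, s_conj T i a a b,
        Equiv.swap_apply_right, Equiv.swap_apply_of_ne_of_ne hbi hab.symm]
    simp only [add_mul, mul_add, sub_mul] at *
    rw [h1, h2, h3, h4]
    rw [← sub_eq_zero] at key ⊢
    rw [← key]
    abel

lemma eta_sub_mul_eta_sub {a b : X} (hab : a ≠ b) {P : Finset X} (ha : a ∉ P) (hb : b ∉ P)
    (x : ℂ) :
    (T.eta b (insert a P) - x • 1) * (T.eta a P - x • 1) =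
      (T.eta a (insert b P) - x • 1) * (T.eta b P - x • 1) := by
  rw [eta_insert _ ha, eta_insert _ hb, s_symm T b a]
  have h1 := T.swap_mul_eta ha hb
  have h2 := T.swap_mul_eta hb ha
  rw [s_symm T b a] at h2
  have h3 := T.eta_bracket hab ha hb
  simp only [sub_mul, mul_sub, add_mul, smul_mul_assoc, mul_smul_comm, one_mul, mul_one,
    smul_sub, smul_add] at *
  rw [h1, h2]
  rw [← sub_eq_zero] at h3 ⊢
  rw [← neg_eq_zero, ← h3]
  abel

/-- The product `∏ (ε_m - x)` over the members of a list, for the order in which the list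
succeeds `P`. -/
def Z : List X → Finset X → ℂ → Module.End ℂ M
  | [], _, _ => 1
  | m :: l, P, x => Z l (insert m P) x * (T.eta m P - x • 1)

lemma Z_perm {l l' : List X} (h : l.Perm l') : ∀ {P : Finset X}, l.Nodup →
    (∀ m ∈ l, m ∉ P) → ∀ x, T.Z l P x = T.Z l' P x := by
  induction h with
  | nil => intros; rfl
  | cons a _ ih =>
    intro P hn hP x
    rw [List.nodup_cons] at hn
    simp only [Z]
    rw [ih hn.2]
    intro m hm
    rw [Finset.mem_insert, not_or]
    exact ⟨fun h => hn.1 (h ▸ hm), hP m (List.mem_cons_of_mem _ hm)⟩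
  | swap a b l =>
    intro P hn hP x
    have hab : b ≠ a := by
      rintro rfl
      simp at hn
    simp only [Z, mul_assoc]
    rw [T.eta_sub_mul_eta_sub hab (hP b (by simp)) (hP a (by simp)), Finset.insert_comm]
  | trans h1 _ ih1 ih2 =>
    intro P hn hP x
    rw [ih1 hn hP, ih2 (h1.nodup_iff.1 hn) fun m hm => hP m (h1.mem_iff.2 hm)]

lemma Z_append (l₁ l₂ : List X) (P : Finset X) (x : ℂ) :
    T.Z (l₁ ++ l₂) P x = T.Z l₂ (P ∪ l₁.toFinset) x * T.Z l₁ P x := by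
  induction l₁ generalizing P with
  | nil => simp [Z]
  | cons a l ih =>
    simp only [List.cons_append, Z, ih, mul_assoc, List.toFinset_cons]
    rw [Finset.insert_union, Finset.union_insert]

lemma S_mul_Z (w : Equiv.Perm X) (l : List X) (P : Finset X) (x : ℂ) :
    T.S w * T.Z l P x = T.Z (l.map w) (P.map w.toEmbedding) x * T.S w := by
  induction l generalizing P with
  | nil => simp [Z]
  | cons a l ih =>
    simp only [List.map_cons, Z]
    rw [← mul_assoc, ih, Finset.map_insert, mul_assoc, mul_assoc, mul_sub, S_mul_eta, sub_mul]
    simp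

lemma s_Z {a b : X} {l : List X} (hn : l.Nodup) {P : Finset X} (hP : ∀ m ∈ l, m ∉ P)
    (ha : a ∈ l) (hb : b ∈ l) (x : ℂ) (v : M) :
    T.s a b (T.Z l P x v) = T.Z l P x (T.s a b v) := by
  have h := LinearMap.congr_fun (T.S_mul_Z (Equiv.swap a b) l P x) v
  have hperm : (l.map (Equiv.swap a b)).Perm l := by
    rw [List.perm_ext_iff_of_nodup (hn.map (Equiv.injective _)) hn]
    intro c
    have h2 : c ∈ l.toFinset.map (Equiv.swap a b).toEmbedding ↔ c ∈ l.toFinset := by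
      rw [map_swap_of_mem (by simpa using ha) (by simpa using hb)]
    simpa only [Finset.mem_map, List.mem_toFinset, List.mem_map, Equiv.coe_toEmbedding] using h2
  rw [map_swap_of_notMem (hP a ha) (hP b hb),
    T.Z_perm hperm (hn.map (Equiv.injective _))
      (fun m hm => hP m (hperm.mem_iff.1 hm))] at h
  exact h

lemma exists_polynomial_Z (g : Module.Dual ℂ M) (l : List X) :
    ∀ (P : Finset X) (v : M), ∃ p : Polynomial ℂ, ∀ x, g (T.Z l P x v) = p.eval x := by
  induction l with
  | nil => exact fun P v => ⟨Polynomial.C (g v), fun x => by simp [Z]⟩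
  | cons m l ih =>
    intro P v
    obtain ⟨p, hp⟩ := ih (insert m P) (T.eta m P v)
    obtain ⟨p', hp'⟩ := ih (insert m P) v
    refine ⟨p - Polynomial.X * p', fun x => ?_⟩
    simp [Z, hp, hp']

/-- A polynomial factor can be cancelled from an identity satisfied by `∏ (ε_m - x) v`. -/
lemma Z_apply_of_mul {l : List X} {P : Finset X} {v : M} {p q : Polynomial ℂ} (hp : p ≠ 0)
    (h : ∀ x, p.eval x • T.Z l P x v = (p.eval x * q.eval x) • v) (x : ℂ) :
    T.Z l P x v = q.eval x • v := by
  rw [← sub_eq_zero, ← Module.forall_dual_apply_eq_zero_iff ℂ]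
  intro g
  obtain ⟨f, hf⟩ := T.exists_polynomial_Z g l P v
  have : p * f = p * (q * Polynomial.C (g v)) := by
    apply Polynomial.funext
    intro y
    have := congrArg g (h y)
    simp only [map_smul, smul_eq_mul, hf] at this
    simp [this, mul_assoc]
  rw [map_sub, hf, mul_left_cancel₀ hp this]
  simp

end EquivariantAction

namespace EquivariantAction

variable {X M : Type} [DecidableEq X] [AddCommGroup M] [Module ℂ M] (T : EquivariantAction X M)

/-- The members of `B` in the `k`-th row. -/
def rowPart (row : X → ℕ) (B : Finset X) (k : ℕ) : Finset X := B.filter (fun m => row m = k)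

/-- The members of `B` in the rows before the `k`-th one. -/
def rowsBefore (row : X → ℕ) (B : Finset X) (k : ℕ) : Finset X := B.filter (fun m => row m < k)

lemma mem_rowPart {row : X → ℕ} {B : Finset X} {k : ℕ} {m : X} :
    m ∈ rowPart row B k ↔ m ∈ B ∧ row m = k := by simp [rowPart]

lemma mem_rowsBefore {row : X → ℕ} {B : Finset X} {k : ℕ} {m : X} :
    m ∈ rowsBefore row B k ↔ m ∈ B ∧ row m < k := by simp [rowsBefore]

/-- The polynomial `∏ (w - X)`, with `w` running over the weights of the first `j` rows of `B`. -/
def weightPoly (row : X → ℕ) (μ : ℕ → ℂ) (B : Finset X) (j : ℕ) : Polynomial ℂ :=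
  ∏ k ∈ Finset.range j, ∏ t ∈ Finset.range (rowPart row B k).card,
    (Polynomial.C (μ k + t) - Polynomial.X)

lemma weightPoly_ne_zero (row : X → ℕ) (μ : ℕ → ℂ) (B : Finset X) (j : ℕ) :
    weightPoly row μ B j ≠ 0 := by
  refine Finset.prod_ne_zero_iff.2 fun k _ => Finset.prod_ne_zero_iff.2 fun t _ h => ?_
  have := congrArg (Polynomial.eval (μ k + t + 1)) h
  simp at this

lemma Z_row_apply {v : M} {P : Finset X} {c : ℂ} (rl : List X) :
    ∀ U : Finset X, rl.Nodup → (∀ m ∈ rl, m ∉ U) → Disjoint U P → (∀ m ∈ rl, m ∉ P) →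
    (∀ m ∈ rl, T.eta m P v = c • v) → (∀ m ∈ rl, ∀ i ∈ U, T.s i m v = v) →
    (∀ m ∈ rl, ∀ i ∈ rl, T.s i m v = v) → ∀ x,
    T.Z rl (P ∪ U) x v = (∏ t ∈ Finset.range rl.length, (c + (U.card + t : ℕ) - x)) • v := by
  induction rl with
  | nil => intros; simp [Z]
  | cons m l ih =>
    intro U hn hU hUP hP he hs hs' x
    rw [List.nodup_cons] at hn
    have hm : T.eta m (P ∪ U) v = (c + U.card) • v := by
      rw [eta_apply, Finset.sum_union hUP.symm, ← add_assoc, ← eta_apply, he m (by simp),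
        Finset.sum_congr rfl (hs m (by simp)), Finset.sum_const, add_smul, Nat.cast_smul_eq_nsmul]
    rw [Z, Module.End.mul_apply, LinearMap.sub_apply, hm, LinearMap.smul_apply,
      Module.End.one_apply, ← sub_smul, map_smul, ← Finset.union_insert,
      ih (insert m U) hn.2 ?_ ?_ ?_ ?_ ?_ ?_ x, smul_smul, List.length_cons,
      Finset.prod_range_succ', mul_comm, Finset.card_insert_of_notMem (hU m (by simp))]
    · simp only [add_zero]
      congr 2
      exact Finset.prod_congr rfl fun t _ => by push_cast; ring
    · intro i hi
      rw [Finset.mem_insert, not_or]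
      exact ⟨fun h => hn.1 (h ▸ hi), hU i (by simp [hi])⟩
    · rw [Finset.disjoint_insert_left]
      exact ⟨hP m (by simp), hUP⟩
    · exact fun i hi => hP i (by simp [hi])
    · exact fun i hi => he i (by simp [hi])
    · intro i hi i' hi'
      rw [Finset.mem_insert] at hi'
      rcases hi' with rfl | hi'
      · exact hs' i (by simp [hi]) i' (by simp)
      · exact hs i (by simp [hi]) i' hi'
    · exact fun i hi i' hi' => hs' i (by simp [hi]) i' (by simp [hi'])

/-- `∏ (ε_m - x)`, over the first `j` rows of `B`, acts on `v` by the scalar read off from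
the weights. -/
def HasWeightPoly (row : X → ℕ) (μ : ℕ → ℂ) (B : Finset X) (j : ℕ) (v : M) : Prop :=
  ∃ l : List X, l.Nodup ∧ l.toFinset = rowsBefore row B j ∧
    ∀ x, T.Z l ∅ x v = (weightPoly row μ B j).eval x • v

variable {T} {row : X → ℕ} {μ : ℕ → ℂ}

lemma HasWeightPoly.succ {B : Finset X} {j : ℕ} {v : M} (h : T.HasWeightPoly row μ B j v)
    (he : ∀ m ∈ B, row m = j → T.eta m (rowsBefore row B j) v = μ j • v)
    (hs : ∀ m ∈ B, ∀ m' ∈ B, row m = j → row m' = j → T.s m m' v = v) :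
    T.HasWeightPoly row μ B (j + 1) v := by
  obtain ⟨l, hl, hlB, hZ⟩ := h
  refine ⟨l ++ (rowPart row B j).toList, ?_, ?_, fun x => ?_⟩
  · refine hl.append (Finset.nodup_toList _) ?_
    intro a ha ha'
    rw [← List.mem_toFinset, hlB, mem_rowsBefore] at ha
    rw [Finset.mem_toList, mem_rowPart] at ha'
    omega
  · ext a
    rw [List.toFinset_append, Finset.mem_union, hlB, Finset.toList_toFinset, mem_rowsBefore,
      mem_rowPart, mem_rowsBefore, Nat.lt_succ_iff_lt_or_eq]
    tauto
  · have key := T.Z_row_apply (v := v) (P := rowsBefore row B j) (c := μ j)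
      (rowPart row B j).toList ∅ (Finset.nodup_toList _) (by simp) (by simp)
      (by simp +contextual [mem_rowPart, mem_rowsBefore])
      (by simpa [mem_rowPart] using he) (by simp)
      (by
        intro m hm i hi
        rw [Finset.mem_toList, mem_rowPart] at hm hi
        exact hs i hi.1 m hm.1 hi.2 hm.2) x
    rw [Z_append, Module.End.mul_apply, hZ, map_smul, hlB, Finset.empty_union]
    rw [Finset.union_empty] at key
    rw [key, smul_smul, weightPoly, weightPoly, Finset.prod_range_succ, Polynomial.eval_mul]
    congr 2
    rw [Polynomial.eval_prod]
    simp

lemma hasWeightPoly_of_eta {B : Finset X} {v : M} (j : ℕ)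
    (he : ∀ m ∈ B, row m < j → T.eta m (rowsBefore row B (row m)) v = μ (row m) • v)
    (hs : ∀ m ∈ B, ∀ m' ∈ B, row m = row m' → T.s m m' v = v) :
    T.HasWeightPoly row μ B j v := by
  induction j with
  | zero => exact ⟨[], by simp, by ext; simp [mem_rowsBefore], by simp [Z, weightPoly]⟩
  | succ j ih =>
    refine (ih fun m hm hj => he m hm (by omega)).succ ?_ ?_
    · rintro m hm rfl
      exact he m hm (by omega)
    · exact fun m hm m' hm' h h' => hs m hm m' hm' (h.trans h'.symm)

variable (T row μ)

/-- `v` is row-symmetric and satisfies the relations of a standard module on `A`, except that in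
the rows before the `j`-th one the column `C` of `A` has been split off and antisymmetrized. -/
structure ColumnState (A C : Finset X) (j : ℕ) (v : M) : Prop where
  subset : C ⊆ rowsBefore row A j
  antisymm : ∀ a ∈ C, ∀ b ∈ C, a ≠ b → T.s a b v = -v
  symm : ∀ m ∈ A \ C, ∀ m' ∈ A \ C, row m = row m' → T.s m m' v = v
  eta_lt : ∀ m ∈ A \ C, row m < j → T.eta m (rowsBefore row (A \ C) (row m)) v = μ (row m) • v
  eta_ge : ∀ m ∈ A, j ≤ row m → T.eta m (rowsBefore row A (row m)) v = μ (row m) • v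
  weight : T.HasWeightPoly row μ A j v

variable {T row μ}

lemma ColumnState.eta_of_antisymm_eq {A C : Finset X} {j : ℕ} {v : M} {q : X}
    (h : T.ColumnState row μ A C j v)
    (hq : q ∈ A) (hqj : row q = j) (hv : v - ∑ i ∈ C, T.s i q v = 0) {i₀ : X} (hi : i₀ ∈ C) :
    T.eta i₀ (rowsBefore row (A \ C) j) (T.s i₀ q v) = (μ j - 1) • T.s i₀ q v := by
  have hC := h.subset
  have hi₀ := mem_rowsBefore.1 (hC hi)
  have hqC : q ∉ C := fun hqC => by
    have := (mem_rowsBefore.1 (hC hqC)).2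
    omega
  have h1 := h.eta_ge q hq hqj.ge
  rw [hqj, eta_apply] at h1
  have h2 : rowsBefore row A j = rowsBefore row (A \ C) j ∪ C := by
    ext a
    rw [Finset.mem_union, mem_rowsBefore, mem_rowsBefore, Finset.mem_sdiff]
    have : a ∈ C → a ∈ A ∧ row a < j := fun ha => mem_rowsBefore.1 (hC ha)
    tauto
  have h3 : Disjoint (rowsBefore row (A \ C) j) C := by
    rw [Finset.disjoint_left]
    intro a ha
    exact (Finset.mem_sdiff.1 (mem_rowsBefore.1 ha).1).2
  rw [h2, Finset.sum_union h3, ← add_assoc, ← eta_apply] at h1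
  rw [sub_eq_zero] at hv
  rw [← hv] at h1
  have h4 : T.eta q (rowsBefore row (A \ C) j) v = (μ j - 1) • v := by
    rw [sub_smul, one_smul, ← h1, add_sub_cancel_right]
  have h5 := congrArg (T.s i₀ q) h4
  rw [map_smul, s, S_eta, Equiv.swap_apply_right, map_swap_of_notMem] at h5
  · exact h5
  · exact fun ha => (Finset.mem_sdiff.1 (mem_rowsBefore.1 ha).1).2 hi
  · exact fun ha => by
      have := (mem_rowsBefore.1 ha).2
      omega

/-- Antisymmetrizing does not kill `v`, provided `μ_j - 1` is not the weight of the members of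
the column. -/
lemma ColumnState.antisymm_ne_zero {A C : Finset X} {j : ℕ} {v : M} {q : X}
    (h : T.ColumnState row μ A C j v)
    (hq : q ∈ A) (hqj : row q = j) {Q : Polynomial ℂ}
    (hQ : weightPoly row μ A j = weightPoly row μ (A \ C) j * Q) (hQ0 : Q.eval (μ j - 1) ≠ 0)
    (hv0 : v ≠ 0) : v - ∑ i ∈ C, T.s i q v ≠ 0 := by
  intro hv
  have hC := h.subset
  have hqC : q ∉ C := fun hqC => by
    have := (mem_rowsBefore.1 (hC hqC)).2
    omega
  obtain ⟨l, hl, hlA, hlZ⟩ := h.weight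
  obtain ⟨l₁, hl₁, hl₁A, hl₁Z⟩ := hasWeightPoly_of_eta j h.eta_lt h.symm
  have hdisj : ∀ m ∈ C, m ∉ rowsBefore row (A \ C) j := fun m hm hm' =>
    (Finset.mem_sdiff.1 (mem_rowsBefore.1 hm').1).2 hm
  have hD : ∀ l₂ : List X, l₂.Nodup → l₂.toFinset = C → ∀ x,
      T.Z l₂ (rowsBefore row (A \ C) j) x v = Q.eval x • v := by
    intro l₂ hl₂ hl₂C
    apply Z_apply_of_mul T (weightPoly_ne_zero row μ (A \ C) j)
    intro x
    have hn : (l₁ ++ l₂).Nodup := by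
      refine hl₁.append hl₂ ?_
      intro a ha ha'
      rw [← List.mem_toFinset, hl₁A] at ha
      rw [← List.mem_toFinset, hl₂C] at ha'
      exact hdisj a ha' ha
    have hperm : l.Perm (l₁ ++ l₂) := by
      rw [List.perm_ext_iff_of_nodup hl hn]
      intro a
      rw [← List.mem_toFinset, ← List.mem_toFinset, List.toFinset_append, hlA, hl₁A, hl₂C,
        Finset.mem_union, mem_rowsBefore, mem_rowsBefore, Finset.mem_sdiff]
      have : a ∈ C → a ∈ A ∧ row a < j := fun ha => mem_rowsBefore.1 (hC ha)
      tauto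
    have := hlZ x
    rw [T.Z_perm hperm hl (by simp), Z_append, Module.End.mul_apply, hl₁Z, map_smul,
      Finset.empty_union, hl₁A, hQ, Polynomial.eval_mul] at this
    exact this
  rcases C.eq_empty_or_nonempty with rfl | ⟨i₀, hi₀⟩
  · simp at hv
    exact hv0 hv
  · obtain ⟨l₂, hl₂, hl₂C⟩ : ∃ l₂ : List X, (i₀ :: l₂).Nodup ∧ (i₀ :: l₂).toFinset = C := by
      refine ⟨(C.erase i₀).toList, ?_, ?_⟩
      · simp [Finset.nodup_toList]
      · simp [Finset.insert_erase hi₀]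
    have h0 : T.Z (i₀ :: l₂) (rowsBefore row (A \ C) j) (μ j - 1) (T.s i₀ q v) = 0 := by
      rw [Z, Module.End.mul_apply, LinearMap.sub_apply, h.eta_of_antisymm_eq hq hqj hv hi₀]
      simp
    have hmem : ∀ m, m ∈ i₀ :: l₂ ↔ m ∈ C := by
      intro m
      rw [← List.mem_toFinset, hl₂C]
    have h1 : ∀ i ∈ C,
        T.Z (i₀ :: l₂) (rowsBefore row (A \ C) j) (μ j - 1) (T.s i q v) = 0 := by
      intro i hi
      by_cases hii : i = i₀
      · rw [hii, h0]
      · have hqi : q ≠ i := fun h => hqC (h ▸ hi)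
        have hqi₀ : q ≠ i₀ := fun h => hqC (h ▸ hi₀)
        have h2 : T.s i q v = -T.s i i₀ (T.s i₀ q v) := by
          rw [s_conj T i i₀, Equiv.swap_apply_right, Equiv.swap_apply_of_ne_of_ne hqi hqi₀,
            h.antisymm i hi i₀ hi₀ hii, map_neg, neg_neg]
        rw [h2, map_neg, ← s_Z T hl₂ (fun m hm => hdisj m ((hmem m).1 hm)) ((hmem i).2 hi)
          ((hmem i₀).2 hi₀), h0]
        simp
    have h2 := hD _ hl₂ hl₂C (μ j - 1)
    rw [sub_eq_zero] at hv
    nth_rewrite 1 [hv] at h2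
    rw [map_sum, Finset.sum_eq_zero h1] at h2
    exact smul_ne_zero hQ0 hv0 h2.symm

/-- Passing a row which does not meet the column. -/
lemma ColumnState.skip {A C : Finset X} {j : ℕ} {v : M} (h : T.ColumnState row μ A C j v)
    (hj : ∀ m ∈ A, row m ≠ j) : T.ColumnState row μ A C (j + 1) v where
  subset := h.subset.trans fun m hm => by
    rw [mem_rowsBefore] at hm ⊢
    exact ⟨hm.1, by omega⟩
  antisymm := h.antisymm
  symm := h.symm
  eta_lt m hm hmj := h.eta_lt m hm (by
    have := hj m (Finset.mem_sdiff.1 hm).1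
    omega)
  eta_ge m hm hmj := h.eta_ge m hm (by omega)
  weight := h.weight.succ (fun m hm hmj => absurd hmj (hj m hm))
    (fun m hm _ _ hmj => absurd hmj (hj m hm))

lemma ColumnState.rowsBefore_eq {A C : Finset X} {j : ℕ} {v : M}
    (h : T.ColumnState row μ A C j v) (k : ℕ) (hk : j ≤ k) :
    rowsBefore row A k = rowsBefore row (A \ C) k ∪ C := by
  ext a
  rw [Finset.mem_union, mem_rowsBefore, mem_rowsBefore, Finset.mem_sdiff]
  have : a ∈ C → a ∈ A ∧ row a < k := fun ha => by
    have := mem_rowsBefore.1 (h.subset ha)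
    exact ⟨this.1, by omega⟩
  tauto

lemma ColumnState.disjoint {A C : Finset X} {j : ℕ} {v : M}
    (_ : T.ColumnState row μ A C j v) (k : ℕ) : Disjoint (rowsBefore row (A \ C) k) C := by
  rw [Finset.disjoint_left]
  intro a ha
  exact (Finset.mem_sdiff.1 (mem_rowsBefore.1 ha).1).2

lemma sum_s_s_of_antisymm {C : Finset X} {v : M} {q m : X}
    (hC : ∀ a ∈ C, ∀ b ∈ C, a ≠ b → T.s a b v = -v) (hq : q ∉ C) (hm : m ∉ C) (hqm : q ≠ m)
    (hv : T.s q m v = v) :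
    ∑ i ∈ C, ∑ i' ∈ C, T.s i q (T.s i' m v) = ∑ i ∈ C, T.s i m v := by
  have hF : ∀ i ∈ C, ∀ i' ∈ C, T.s i q (T.s i' m v) + T.s i' q (T.s i m v) =
      if i = i' then (2 : ℂ) • T.s i m v else 0 := by
    intro i hi i' hi'
    have hiq : i ≠ q := fun h => hq (h ▸ hi)
    have hi'q : i' ≠ q := fun h => hq (h ▸ hi')
    have him : i ≠ m := fun h => hm (h ▸ hi)
    have hi'm : i' ≠ m := fun h => hm (h ▸ hi')
    split_ifs with hii
    · subst hii
      rw [two_smul, s_conj T i q i m, Equiv.swap_apply_left,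
        Equiv.swap_apply_of_ne_of_ne him.symm hqm.symm, s_conj T q m i q,
        Equiv.swap_apply_of_ne_of_ne hiq him, Equiv.swap_apply_left, hv]
    · have h1 : T.s i q (T.s i' m (T.s i i' v)) = T.s i' q (T.s i m (T.s q m v)) := by
        simp only [s, ← Module.End.mul_apply, ← map_mul]
        congr 2
        ext x
        simp only [Equiv.Perm.mul_apply, Equiv.swap_apply_def]
        grind
      rw [hC i hi i' hi' hii, hv, map_neg, map_neg] at h1
      rw [← h1, add_neg_cancel]
  have h2 : (2 : ℂ) • ∑ i ∈ C, ∑ i' ∈ C, T.s i q (T.s i' m v) = (2 : ℂ) • ∑ i ∈ C, T.s i m v := by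
    rw [two_smul]
    nth_rewrite 2 [Finset.sum_comm]
    rw [← Finset.sum_add_distrib, Finset.smul_sum]
    refine Finset.sum_congr rfl fun i hi => ?_
    rw [← Finset.sum_add_distrib, Finset.sum_congr rfl (hF i hi), Finset.sum_ite_eq, if_pos hi]
  exact smul_right_injective M two_ne_zero h2

/-- Antisymmetrizing over one more member `q` of the column. -/
lemma ColumnState.extend {A C : Finset X} {j : ℕ} {v : M} {q : X}
    (h : T.ColumnState row μ A C j v) (hq : q ∈ A) (hqj : row q = j) :
    T.ColumnState row μ A (insert q C) (j + 1) (v - ∑ i ∈ C, T.s i q v) := by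
  have hC := h.subset
  have hqC : q ∉ C := fun hqC => by
    have := (mem_rowsBefore.1 (hC hqC)).2
    omega
  have hne : ∀ i ∈ C, i ≠ q := fun i hi h => hqC (h ▸ hi)
  have hsdiff : ∀ m, m ∈ A \ insert q C ↔ m ∈ A \ C ∧ m ≠ q := by
    intro m
    simp only [Finset.mem_sdiff, Finset.mem_insert, not_or]
    tauto
  have hanti : ∀ a ∈ C, T.s a q (v - ∑ i ∈ C, T.s i q v) = -(v - ∑ i ∈ C, T.s i q v) := by
    intro a ha
    have h1 : ∀ i ∈ C.erase a, T.s a q (T.s i q v) = - T.s i q v := by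
      intro i hi
      rw [Finset.mem_erase] at hi
      have h2 : T.s i q (T.s i a v) = T.s a q (T.s i q v) := by
        rw [s_symm T i a, s_conj T i q a i, Equiv.swap_apply_left,
          Equiv.swap_apply_of_ne_of_ne hi.1.symm (hne a ha)]
      rw [← h2, h.antisymm i hi.2 a ha hi.1, map_neg]
    rw [map_sub, map_sum, ← Finset.add_sum_erase C _ ha, Finset.sum_congr rfl h1, s_s,
      ← Finset.add_sum_erase C (fun i => T.s i q v) ha, Finset.sum_neg_distrib]
    abel
  refine ⟨?_, ?_, ?_, ?_, ?_, ?_⟩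
  · intro m hm
    rw [mem_rowsBefore]
    rcases Finset.mem_insert.1 hm with rfl | hm
    · exact ⟨hq, by omega⟩
    · have := mem_rowsBefore.1 (hC hm)
      exact ⟨this.1, by omega⟩
  · intro a ha b hb hab
    rcases Finset.mem_insert.1 ha with rfl | ha'
    · rcases Finset.mem_insert.1 hb with rfl | hb'
      · exact absurd rfl hab
      · rw [s_symm]
        exact hanti b hb'
    · rcases Finset.mem_insert.1 hb with rfl | hb'
      · exact hanti a ha'
      · rw [map_sub, map_sum, h.antisymm a ha' b hb' hab]
        have h1 : ∀ i ∈ C, T.s a b (T.s i q v) = - T.s (Equiv.swap a b i) q v := by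
          intro i _
          rw [s_conj, Equiv.swap_apply_of_ne_of_ne (hne a ha').symm (hne b hb').symm,
            h.antisymm a ha' b hb' hab, map_neg]
        rw [Finset.sum_congr rfl h1, Finset.sum_neg_distrib]
        have h2 : ∑ i ∈ C, T.s (Equiv.swap a b i) q v = ∑ i ∈ C, T.s i q v := by
          conv_rhs => rw [← map_swap_of_mem ha' hb', Finset.sum_map]
          rfl
        rw [h2]
        abel
  · intro m hm m' hm' hmm'
    rw [hsdiff] at hm hm'
    rw [map_sub, map_sum, h.symm m hm.1 m' hm'.1 hmm']
    congr 1
    refine Finset.sum_congr rfl fun i hi => ?_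
    have hi1 : ∀ m ∈ A \ C, i ≠ m := fun m hm h => (Finset.mem_sdiff.1 hm).2 (h ▸ hi)
    rw [s_comm T (hi1 m hm.1) (hi1 m' hm'.1) hm.2.symm hm'.2.symm, h.symm m hm.1 m' hm'.1 hmm']
  · intro m hm hmj
    rw [hsdiff] at hm
    have hP : rowsBefore row (A \ insert q C) (row m) = rowsBefore row (A \ C) (row m) := by
      ext a
      rw [mem_rowsBefore, mem_rowsBefore, hsdiff]
      constructor
      · exact fun h => ⟨h.1.1, h.2⟩
      · refine fun h => ⟨⟨h.1, ?_⟩, h.2⟩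
        rintro rfl
        omega
    have hmC : ∀ i ∈ C, m ≠ i := fun i hi h => (Finset.mem_sdiff.1 hm.1).2 (h ▸ hi)
    have heta : ∀ i ∈ C, T.eta m (rowsBefore row (A \ C) (row m)) (T.s i q v) =
        T.s i q (T.eta m (rowsBefore row (A \ C) (row m)) v) := by
      intro i hi
      rw [s, S_eta, Equiv.swap_apply_of_ne_of_ne (hmC i hi) hm.2, map_swap_of_notMem]
      · exact fun ha => (Finset.mem_sdiff.1 (mem_rowsBefore.1 ha).1).2 hi
      · intro ha
        have := (mem_rowsBefore.1 ha).2
        omega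
    rw [hP, map_sub, map_sum, Finset.sum_congr rfl heta, smul_sub, Finset.smul_sum]
    rcases Nat.lt_succ_iff_lt_or_eq.1 hmj with hmj | hmj
    · rw [h.eta_lt m hm.1 hmj]
      simp only [map_smul]
    · have h1 := h.eta_ge m (Finset.mem_sdiff.1 hm.1).1 hmj.ge
      rw [h.rowsBefore_eq (row m) hmj.ge, eta_apply, Finset.sum_union (h.disjoint _),
        ← add_assoc, ← eta_apply, ← eq_sub_iff_add_eq] at h1
      simp only [h1, map_sub, map_sum, map_smul, Finset.sum_sub_distrib]
      rw [sum_s_s_of_antisymm h.antisymm hqC (fun hmC' => hmC m hmC' rfl) hm.2.symm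
        (h.symm q (Finset.mem_sdiff.2 ⟨hq, hqC⟩) m hm.1 (hqj.trans hmj.symm))]
      abel
  · intro m hm hmj
    have hmC : ∀ i ∈ C, i ≠ m := by
      rintro i hi rfl
      have := (mem_rowsBefore.1 (hC hi)).2
      omega
    have hmq : q ≠ m := by
      rintro rfl
      omega
    rw [map_sub, map_sum, h.eta_ge m hm (by omega), smul_sub, Finset.smul_sum]
    congr 1
    refine Finset.sum_congr rfl fun i hi => ?_
    rw [← map_smul, ← h.eta_ge m hm (by omega), s, S_eta,
      Equiv.swap_apply_of_ne_of_ne (hmC i hi).symm hmq.symm, map_swap_of_mem]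
    · have := mem_rowsBefore.1 (hC hi)
      exact mem_rowsBefore.2 ⟨this.1, by omega⟩
    · exact mem_rowsBefore.2 ⟨hq, by omega⟩
  · obtain ⟨l, hl, hlA, hZ⟩ : T.HasWeightPoly row μ A (j + 1) v := by
      refine h.weight.succ ?_ ?_
      · rintro m hm rfl
        exact h.eta_ge m hm le_rfl
      · intro m hm m' hm' hmj hmj'
        have : ∀ m ∈ A, row m = j → m ∈ A \ C := by
          intro m hm hmj
          refine Finset.mem_sdiff.2 ⟨hm, fun hmC => ?_⟩
          have := (mem_rowsBefore.1 (hC hmC)).2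
          omega
        exact h.symm m (this m hm hmj) m' (this m' hm' hmj') (hmj.trans hmj'.symm)
    refine ⟨l, hl, hlA, fun x => ?_⟩
    rw [map_sub, map_sum, hZ, smul_sub, Finset.smul_sum]
    congr 1
    refine Finset.sum_congr rfl fun i hi => ?_
    rw [← s_Z T hl (by simp), hZ, map_smul]
    · rw [← List.mem_toFinset, hlA, mem_rowsBefore]
      have := mem_rowsBefore.1 (hC hi)
      exact ⟨this.1, by omega⟩
    · rw [← List.mem_toFinset, hlA, mem_rowsBefore]
      exact ⟨hq, by omega⟩

end EquivariantAction

/-- A labelling of `X` by the cells of an array with `r` rows of lengths `len`. -/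
structure CellLabelling (X : Type) (r : ℕ) (len : ℕ → ℕ) where
  row : X → ℕ
  col : X → ℕ
  row_lt : ∀ m, row m < r
  col_lt : ∀ m, col m < len (row m)
  injective : ∀ m m', row m = row m' → col m = col m' → m = m'
  surjective : ∀ k < r, ∀ c < len k, ∃ m, row m = k ∧ col m = c

namespace CellLabelling

variable {X : Type} [DecidableEq X] [Fintype X] {r : ℕ} {len : ℕ → ℕ} (Λ : CellLabelling X r len)

/-- The cells in the columns from the `t`-th one on. -/
def fromColumn (t : ℕ) : Finset X := Finset.univ.filter fun m => t ≤ Λ.col m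

/-- The cells of the `t`-th column in the first `j` rows. -/
def columnPart (t j : ℕ) : Finset X := Finset.univ.filter fun m => Λ.col m = t ∧ Λ.row m < j

variable {Λ}

lemma mem_fromColumn {t : ℕ} {m : X} : m ∈ Λ.fromColumn t ↔ t ≤ Λ.col m := by
  simp [fromColumn]

lemma mem_columnPart {t j : ℕ} {m : X} :
    m ∈ Λ.columnPart t j ↔ Λ.col m = t ∧ Λ.row m < j := by
  simp [columnPart]

lemma card_rowPart {B : Finset X} {k t : ℕ} (hk : k < r)
    (hB : ∀ m, Λ.row m = k → (m ∈ B ↔ t ≤ Λ.col m)) :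
    (EquivariantAction.rowPart Λ.row B k).card = len k - t := by
  rw [← Nat.card_Ico, ← Finset.card_image_of_injOn (f := Λ.col)]
  · congr 1
    ext c
    simp only [Finset.mem_image, EquivariantAction.mem_rowPart, Finset.mem_Ico]
    constructor
    · rintro ⟨m, ⟨hm, hmk⟩, rfl⟩
      exact ⟨(hB m hmk).1 hm, hmk ▸ Λ.col_lt m⟩
    · rintro ⟨h1, h2⟩
      obtain ⟨m, hm, rfl⟩ := Λ.surjective k hk c h2
      exact ⟨m, ⟨(hB m hm).2 h1, hm⟩, rfl⟩
  · intro m hm m' hm' h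
    rw [Finset.mem_coe, EquivariantAction.mem_rowPart] at hm hm'
    exact Λ.injective m m' (hm.2.trans hm'.2.symm) h

lemma weightPoly_fromColumn (μ : ℕ → ℂ) (t : ℕ) {j : ℕ} (hj : j ≤ r) :
    EquivariantAction.weightPoly Λ.row μ (Λ.fromColumn t) j =
      EquivariantAction.weightPoly Λ.row μ (Λ.fromColumn t \ Λ.columnPart t j) j *
        ∏ k ∈ Finset.range j, if t < len k then
          Polynomial.C (μ k + (len k - (t + 1) : ℕ)) - Polynomial.X else 1 := by
  rw [EquivariantAction.weightPoly, EquivariantAction.weightPoly, ← Finset.prod_mul_distrib]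
  refine Finset.prod_congr rfl fun k hk => ?_
  rw [Finset.mem_range] at hk
  rw [card_rowPart (t := t) (by omega) (fun m _ => mem_fromColumn),
    card_rowPart (t := t + 1) (by omega)]
  · split_ifs with h
    · obtain ⟨d, hd⟩ := Nat.exists_eq_add_of_lt h
      rw [hd, show t + d + 1 - t = d + 1 by omega, show t + d + 1 - (t + 1) = d by omega,
        Finset.prod_range_succ]
    · rw [show len k - t = 0 by omega, show len k - (t + 1) = 0 by omega, mul_one]
  · intro m hm
    rw [Finset.mem_sdiff, mem_fromColumn, mem_columnPart]
    omega

end CellLabelling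

namespace EquivariantAction

variable {X M : Type} [DecidableEq X] [Fintype X] [AddCommGroup M] [Module ℂ M]
  {T : EquivariantAction X M} {r : ℕ} {len : ℕ → ℕ} {Λ : CellLabelling X r len} {μ : ℕ → ℂ}

lemma ColumnState.exists_succ {t j : ℕ} {v : M}
    (hdom : ∀ i j, i < j → j < r → ∀ N : ℕ, (μ i + len i) - (μ j + len j) ≠ -((N : ℂ) + 1))
    (hj : j < r) (hv : v ≠ 0)
    (h : T.ColumnState Λ.row μ (Λ.fromColumn t) (Λ.columnPart t j) j v)
    (hold : ∀ a b, a ≠ b → Λ.col a < t → Λ.col a = Λ.col b → T.s a b v = -v) :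
    ∃ v' ≠ 0, T.ColumnState Λ.row μ (Λ.fromColumn t) (Λ.columnPart t (j + 1)) (j + 1) v' ∧
      ∀ a b, a ≠ b → Λ.col a < t → Λ.col a = Λ.col b → T.s a b v' = -v' := by
  by_cases ht : t < len j
  · obtain ⟨q, hqj, hqt⟩ := Λ.surjective j hj t ht
    have hq : q ∈ Λ.fromColumn t := CellLabelling.mem_fromColumn.2 hqt.ge
    have hC : Λ.columnPart t (j + 1) = insert q (Λ.columnPart t j) := by
      ext m
      rw [Finset.mem_insert, CellLabelling.mem_columnPart, CellLabelling.mem_columnPart]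
      constructor
      · rintro ⟨h1, h2⟩
        rcases Nat.lt_succ_iff_lt_or_eq.1 h2 with h2 | h2
        · exact Or.inr ⟨h1, h2⟩
        · exact Or.inl (Λ.injective m q (h2.trans hqj.symm) (h1.trans hqt.symm))
      · rintro (rfl | h)
        · exact ⟨hqt, by omega⟩
        · exact ⟨h.1, by omega⟩
    refine ⟨_, h.antisymm_ne_zero hq hqj (CellLabelling.weightPoly_fromColumn μ t hj.le) ?_ hv,
      hC ▸ h.extend hq hqj, ?_⟩
    · rw [Polynomial.eval_prod]
      refine Finset.prod_ne_zero_iff.2 fun k hk => ?_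
      rw [Finset.mem_range] at hk
      split_ifs with hkt
      · intro h0
        refine hdom k j hk hj (len j - (t + 1)) ?_
        simp only [Polynomial.eval_sub, Polynomial.eval_C, Polynomial.eval_X] at h0
        rw [Nat.cast_sub (by omega)] at h0 ⊢
        push_cast at h0 ⊢
        linear_combination h0
      · simp
    · intro a b hab hat hcol
      rw [map_sub, map_sum, hold a b hab hat hcol, neg_sub', sub_right_inj,
        ← Finset.sum_neg_distrib]
      refine Finset.sum_congr rfl fun i hi => ?_
      rw [CellLabelling.mem_columnPart] at hi
      rw [s_comm, hold a b hab hat hcol, map_neg] <;> rintro rfl <;> omega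
  · refine ⟨v, hv, ?_, hold⟩
    have hrow : ∀ m ∈ Λ.fromColumn t, Λ.row m ≠ j := by
      rintro m hm rfl
      have := Λ.col_lt m
      have := CellLabelling.mem_fromColumn.1 hm
      omega
    have hC : Λ.columnPart t (j + 1) = Λ.columnPart t j := by
      ext m
      rw [CellLabelling.mem_columnPart, CellLabelling.mem_columnPart]
      have := hrow m
      rw [CellLabelling.mem_fromColumn] at this
      constructor
      · rintro ⟨h1, h2⟩
        exact ⟨h1, by have := this h1.ge; omega⟩
      · exact fun h => ⟨h.1, by omega⟩
    exact hC ▸ h.skip hrow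

/-- `v` satisfies the relations of a standard module on the columns from the `t`-th one on, and
is antisymmetric along the previous ones. -/
structure SplitState (T : EquivariantAction X M) (Λ : CellLabelling X r len) (μ : ℕ → ℂ) (t : ℕ)
    (v : M) : Prop where
  symm : ∀ m ∈ Λ.fromColumn t, ∀ m' ∈ Λ.fromColumn t, Λ.row m = Λ.row m' → T.s m m' v = v
  eta : ∀ m ∈ Λ.fromColumn t,
    T.eta m (rowsBefore Λ.row (Λ.fromColumn t) (Λ.row m)) v = μ (Λ.row m) • v
  antisymm : ∀ a b, a ≠ b → Λ.col a < t → Λ.col a = Λ.col b → T.s a b v = -v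

lemma SplitState.exists_succ {t : ℕ} {v : M}
    (hdom : ∀ i j, i < j → j < r → ∀ N : ℕ, (μ i + len i) - (μ j + len j) ≠ -((N : ℂ) + 1))
    (hv : v ≠ 0) (h : SplitState T Λ μ t v) : ∃ v' ≠ 0, SplitState T Λ μ (t + 1) v' := by
  have key : ∀ j ≤ r, ∃ v' ≠ 0,
      T.ColumnState Λ.row μ (Λ.fromColumn t) (Λ.columnPart t j) j v' ∧
      ∀ a b, a ≠ b → Λ.col a < t → Λ.col a = Λ.col b → T.s a b v' = -v' := by
    intro j
    induction j with
    | zero =>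
      intro _
      have h0 : Λ.columnPart t 0 = ∅ := by ext; simp [CellLabelling.mem_columnPart]
      rw [h0]
      refine ⟨v, hv, ⟨by simp, by simp, ?_, by simp, fun m hm _ => h.eta m hm,
        hasWeightPoly_of_eta 0 (by simp) h.symm⟩, h.antisymm⟩
      simpa using h.symm
    | succ j ih =>
      intro hj
      obtain ⟨v', hv', h1, h2⟩ := ih (by omega)
      exact h1.exists_succ hdom (by omega) hv' h2
  obtain ⟨v', hv', h1, h2⟩ := key r le_rfl
  have hA : Λ.fromColumn t \ Λ.columnPart t r = Λ.fromColumn (t + 1) := by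
    ext m
    rw [Finset.mem_sdiff, CellLabelling.mem_fromColumn, CellLabelling.mem_fromColumn,
      CellLabelling.mem_columnPart]
    have := Λ.row_lt m
    omega
  refine ⟨v', hv', hA ▸ h1.symm, fun m hm => ?_, fun a b hab ha hcol => ?_⟩
  · rw [← hA] at hm ⊢
    exact h1.eta_lt m hm (Λ.row_lt m)
  · rcases Nat.lt_succ_iff_lt_or_eq.1 ha with ha | ha
    · exact h2 a b hab ha hcol
    · exact h1.antisymm a (CellLabelling.mem_columnPart.2 ⟨ha, Λ.row_lt a⟩) b
        (CellLabelling.mem_columnPart.2 ⟨by omega, Λ.row_lt b⟩) hab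

/-- If the weights are dominant, a nonzero vector satisfying the relations of a standard module
gives rise to a nonzero vector which is antisymmetric along the columns. -/
theorem exists_column_antisymmetric {v : M}
    (hdom : ∀ i j, i < j → j < r → ∀ N : ℕ, (μ i + len i) - (μ j + len j) ≠ -((N : ℂ) + 1))
    (hv : v ≠ 0) (hsymm : ∀ m m', Λ.row m = Λ.row m' → T.s m m' v = v)
    (heta : ∀ m, T.eta m (Finset.univ.filter fun i => Λ.row i < Λ.row m) v = μ (Λ.row m) • v) :
    ∃ v' ≠ 0, ∀ a b, a ≠ b → Λ.col a = Λ.col b → T.s a b v' = -v' := by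
  have key : ∀ t, ∃ v' ≠ 0, SplitState T Λ μ t v' := by
    intro t
    induction t with
    | zero =>
      have h0 : Λ.fromColumn 0 = Finset.univ := by ext; simp [CellLabelling.mem_fromColumn]
      exact ⟨v, hv, fun m _ m' _ => hsymm m m', fun m _ => h0 ▸ heta m, by simp⟩
    | succ t ih =>
      obtain ⟨v', hv', h⟩ := ih
      exact h.exists_succ hdom hv'
  obtain ⟨v', hv', h⟩ := key (Finset.univ.sup Λ.col + 1)
  exact ⟨v', hv', fun a b hab => h.antisymm a b hab
    (Nat.lt_succ_of_le (Finset.le_sup (Finset.mem_univ a)))⟩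

end EquivariantAction

theorem Equiv.Perm.adjacent_induction {ℓ : ℕ} {P : Equiv.Perm (Fin ℓ) → Prop} (one : P 1)
    (mul : ∀ w w', P w → P w' → P (w * w'))
    (adj : ∀ (i : Fin ℓ) (h : (i : ℕ) + 1 < ℓ), P (Equiv.swap i ⟨(i : ℕ) + 1, h⟩))
    (w : Equiv.Perm (Fin ℓ)) : P w := by
  cases ℓ with
  | zero => rwa [Subsingleton.elim w 1]
  | succ k =>
    have hw : w ∈ Submonoid.closure
        (Set.range fun i : Fin k => Equiv.swap i.castSucc i.succ) := by
      rw [Equiv.Perm.mclosure_swap_castSucc_succ]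
      trivial
    induction hw using Submonoid.closure_induction with
    | mem x hx =>
      obtain ⟨i, rfl⟩ := hx
      exact adj i.castSucc (by simp)
    | one => exact one
    | mul x y _ _ hx hy => exact mul x y hx hy

namespace Hecke

variable {ℓ : ℕ}

lemma sigma_mul (w w' : Equiv.Perm (Fin ℓ)) : sigma (w * w') = sigma w * sigma w' := by
  rw [sigma, ← RingQuot.mkAlgHom_rel ℂ (HRel.permMul w w'), map_mul]
  rfl

lemma sigma_one : sigma (1 : Equiv.Perm (Fin ℓ)) = 1 := by
  rw [sigma, RingQuot.mkAlgHom_rel ℂ HRel.permOne, map_one]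

lemma sigma_swap_mul_self (a b : Fin ℓ) :
    sigma (Equiv.swap a b) * sigma (Equiv.swap a b) = 1 := by
  rw [← sigma_mul, Equiv.swap_mul_self, sigma_one]

lemma eps_comm (i j : Fin ℓ) : eps i * eps j = eps j * eps i := by
  have := RingQuot.mkAlgHom_rel ℂ (HRel.epsComm i j)
  rwa [map_mul, map_mul] at this

lemma sigma_mul_eps (i j : Fin ℓ) (h : (i : ℕ) + 1 < ℓ) :
    sigma (Equiv.swap i ⟨(i : ℕ) + 1, h⟩) * eps j =
      eps (Equiv.swap i ⟨(i : ℕ) + 1, h⟩ j) * sigma (Equiv.swap i ⟨(i : ℕ) + 1, h⟩) -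
        (((if j = i then 1 else 0) : ℂ) - (if j = ⟨(i : ℕ) + 1, h⟩ then 1 else 0)) • 1 := by
  have := RingQuot.mkAlgHom_rel ℂ (HRel.cross i j h)
  have hneg : ∀ c : ℂ, (-c) • (1 : Hecke ℓ) = -(c • 1) := fun c => neg_smul c (1 : Hecke ℓ)
  rw [map_sub, map_mul, map_mul, map_smul, map_one, hneg, sub_eq_iff_eq_add] at this
  rw [sub_eq_neg_add]
  exact this

lemma eps_eq (m : Fin ℓ) :
    eps m = y m + ∑ j ∈ Finset.univ.filter (fun j : Fin ℓ => j < m), sigma (Equiv.swap j m) := by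
  rw [y, sub_add_cancel]

lemma sigma_mul_sigma_swap (w : Equiv.Perm (Fin ℓ)) (a b : Fin ℓ) :
    sigma w * sigma (Equiv.swap a b) = sigma (Equiv.swap (w a) (w b)) * sigma w := by
  rw [← sigma_mul, ← sigma_mul, Equiv.mul_swap_eq_swap_mul]

lemma sigma_mul_y_left (i : Fin ℓ) (h : (i : ℕ) + 1 < ℓ) :
    sigma (Equiv.swap i ⟨(i : ℕ) + 1, h⟩) * y i =
      y ⟨(i : ℕ) + 1, h⟩ * sigma (Equiv.swap i ⟨(i : ℕ) + 1, h⟩) := by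
  have hne : i ≠ ⟨(i : ℕ) + 1, h⟩ := fun h => by simpa using congrArg Fin.val h
  have hset : Finset.univ.filter (fun j : Fin ℓ => j < ⟨(i : ℕ) + 1, h⟩) =
      insert i (Finset.univ.filter (fun j : Fin ℓ => j < i)) := by
    ext j
    simp only [Finset.mem_filter, Finset.mem_univ, true_and, Finset.mem_insert, Fin.ext_iff,
      Fin.lt_def]
    omega
  rw [y, y, hset, Finset.sum_insert (by simp), mul_sub, sub_mul, add_mul, sigma_mul_eps,
    sigma_swap_mul_self, Finset.mul_sum, Finset.sum_mul]
  have hsum : ∀ j ∈ Finset.univ.filter (fun j : Fin ℓ => j < i),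
      sigma (Equiv.swap i ⟨(i : ℕ) + 1, h⟩) * sigma (Equiv.swap j i) =
        sigma (Equiv.swap j ⟨(i : ℕ) + 1, h⟩) * sigma (Equiv.swap i ⟨(i : ℕ) + 1, h⟩) := by
    intro j hj
    rw [Finset.mem_filter] at hj
    rw [sigma_mul_sigma_swap, Equiv.swap_apply_left, Equiv.swap_apply_of_ne_of_ne hj.2.ne]
    intro hj'
    rw [hj'] at hj
    simp [Fin.lt_def] at hj
  rw [Finset.sum_congr rfl hsum, Equiv.swap_apply_left, if_pos rfl, if_neg hne, sub_zero, one_smul]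
  abel

lemma sigma_adjacent_mul_y (i m : Fin ℓ) (h : (i : ℕ) + 1 < ℓ) :
    sigma (Equiv.swap i ⟨(i : ℕ) + 1, h⟩) * y m =
      y (Equiv.swap i ⟨(i : ℕ) + 1, h⟩ m) * sigma (Equiv.swap i ⟨(i : ℕ) + 1, h⟩) := by
  by_cases hmi : m = i
  · rw [hmi, Equiv.swap_apply_left, sigma_mul_y_left]
  by_cases hmi' : m = ⟨(i : ℕ) + 1, h⟩
  · have := congrArg (fun x => sigma (Equiv.swap i ⟨(i : ℕ) + 1, h⟩) * x *
      sigma (Equiv.swap i ⟨(i : ℕ) + 1, h⟩)) (sigma_mul_y_left i h)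
    rw [← mul_assoc, sigma_swap_mul_self, one_mul, mul_assoc, mul_assoc, sigma_swap_mul_self,
      mul_one] at this
    rw [hmi', Equiv.swap_apply_right, this]
  have hmem : ∀ j, j < m ↔ Equiv.swap i ⟨(i : ℕ) + 1, h⟩ j < m := by
    intro j
    rw [Equiv.swap_apply_def]
    split_ifs <;> simp only [Fin.ext_iff, Fin.lt_def] at * <;> omega
  rw [Equiv.swap_apply_of_ne_of_ne hmi hmi', y, mul_sub, sub_mul, sigma_mul_eps,
    Equiv.swap_apply_of_ne_of_ne hmi hmi', if_neg hmi, if_neg hmi', sub_zero, zero_smul, sub_zero,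
    Finset.mul_sum, Finset.sum_mul]
  congr 1
  refine Finset.sum_equiv (Equiv.swap i ⟨(i : ℕ) + 1, h⟩) (fun j => ?_) fun j _ => ?_
  · rw [Finset.mem_filter, Finset.mem_filter, ← hmem]
    simp
  · rw [sigma_mul_sigma_swap, Equiv.swap_apply_of_ne_of_ne hmi hmi']

lemma sigma_mul_y (w : Equiv.Perm (Fin ℓ)) (m : Fin ℓ) :
    sigma w * y m = y (w m) * sigma w := by
  induction w using Equiv.Perm.adjacent_induction generalizing m with
  | one => simp [sigma_one]
  | mul w w' hw hw' => rw [sigma_mul, mul_assoc, hw', ← mul_assoc, hw, mul_assoc]; rfl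
  | adj i h => exact sigma_adjacent_mul_y i m h

lemma y_bracket {a b : Fin ℓ} (hab : a ≠ b) :
    y a * y b - y b * y a = (y b - y a) * sigma (Equiv.swap a b) := by
  have hℓ : 1 < ℓ := by
    have := a.2
    have := b.2
    have := Fin.val_ne_of_ne hab
    omega
  obtain ⟨i, j, hij, key⟩ : ∃ i j : Fin ℓ, i ≠ j ∧
      y i * y j - y j * y i = (y j - y i) * sigma (Equiv.swap i j) := by
    refine ⟨⟨0, by omega⟩, ⟨0 + 1, hℓ⟩, by simp, ?_⟩
    have h0 : Finset.univ.filter (fun j : Fin ℓ => j < ⟨0, by omega⟩) = ∅ := by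
      ext j
      simp [Fin.lt_def]
    have h1 : Finset.univ.filter (fun j : Fin ℓ => j < ⟨0 + 1, hℓ⟩) = {⟨0, by omega⟩} := by
      ext j
      simp [Fin.lt_def, Fin.ext_iff]
    have h2 := sigma_mul_eps ⟨0, by omega⟩ ⟨0, by omega⟩ hℓ
    rw [if_pos rfl, if_neg (by simp), Equiv.swap_apply_left] at h2
    rw [y, y, h0, h1, Finset.sum_singleton, Finset.sum_empty]
    simp only [sub_zero, mul_sub, sub_mul, sigma_swap_mul_self] at *
    rw [h2, eps_comm, one_smul]
    abel
  obtain ⟨w, rfl, rfl⟩ : ∃ w : Equiv.Perm (Fin ℓ), w i = a ∧ w j = b := by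
    refine ⟨Equiv.swap (Equiv.swap i a j) b * Equiv.swap i a, ?_, ?_⟩
    · rw [Equiv.Perm.mul_apply, Equiv.swap_apply_left, Equiv.swap_apply_of_ne_of_ne _ hab]
      intro h
      have := (Equiv.swap i a).injective (h.symm.trans (Equiv.swap_apply_left i a).symm)
      exact hij this.symm
    · rw [Equiv.Perm.mul_apply, Equiv.swap_apply_left]
  have h := congrArg (fun x => sigma w * x * sigma w⁻¹) key
  have hw : w * (Equiv.swap i j * w⁻¹) = Equiv.swap (w i) (w j) := by
    rw [← mul_assoc, Equiv.mul_swap_eq_swap_mul, mul_inv_cancel_right]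
  simp only [mul_sub, sub_mul, ← mul_assoc, sigma_mul_y] at h
  simpa [mul_assoc, sigma_mul_y, ← sigma_mul, mul_inv_cancel, sigma_one, hw, sub_mul] using h

variable {M : Type} [AddCommGroup M] [Module ℂ M]

/-- An `H_ℓ`-module as an equivariant action. -/
def toEquivariantAction (ρ : Hecke ℓ →ₐ[ℂ] Module.End ℂ M) : EquivariantAction (Fin ℓ) M where
  S :=
    { toFun := fun w => ρ (sigma w)
      map_one' := by rw [sigma_one, map_one]
      map_mul' := fun w w' => by rw [sigma_mul, map_mul] }
  Y m := ρ (y m)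
  equivariant w m := by
    change ρ (sigma w) * ρ (y m) = ρ (y (w m)) * ρ (sigma w)
    rw [← map_mul, sigma_mul_y, map_mul]
  bracket a b hab := by
    change _ = _ * ρ (sigma (Equiv.swap a b))
    rw [← map_mul, ← map_mul, ← map_sub, y_bracket hab, map_mul, map_sub]

/-- A subspace stable under the permutations and the `y_m` is a submodule. -/
lemma hStable_of_sigma_of_y {ρ : Hecke ℓ →ₐ[ℂ] Module.End ℂ M} {p : Submodule ℂ M}
    (hσ : ∀ w, ∀ x ∈ p, ρ (sigma w) x ∈ p) (hy : ∀ m, ∀ x ∈ p, ρ (y m) x ∈ p) :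
    HStable ρ p := by
  intro h
  obtain ⟨h, rfl⟩ := RingQuot.mkAlgHom_surjective ℂ (HRel ℓ) h
  induction h using FreeAlgebra.induction with
  | grade0 c =>
    intro x hx
    rw [AlgHom.commutes, AlgHom.commutes]
    exact p.smul_mem c hx
  | grade1 g =>
    intro x hx
    cases g with
    | perm w => exact hσ w x hx
    | eps m =>
      change ρ (eps m) x ∈ p
      rw [eps_eq, map_add, map_sum, LinearMap.add_apply, LinearMap.sum_apply]
      exact p.add_mem (hy m x hx) (p.sum_mem fun j _ => hσ _ x hx)
  | mul a b ha hb =>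
    intro x hx
    rw [map_mul, map_mul]
    exact ha _ (hb x hx)
  | add a b ha hb =>
    intro x hx
    rw [map_add, map_add]
    exact p.add_mem (ha x hx) (hb x hx)

end Hecke

/-- A linear map between Yangian modules which commutes with the generators is equivariant. -/
lemma Yangian.equivariant_of_t {n : ℕ} {V W : Type} [AddCommGroup V] [Module ℂ V]
    [AddCommGroup W] [Module ℂ W] {π : Yangian n →ₐ[ℂ] Module.End ℂ V}
    {π' : Yangian n →ₐ[ℂ] Module.End ℂ W} {Φ : V →ₗ[ℂ] W}
    (h : ∀ a b d x, Φ (π (Yangian.t a b d) x) = π' (Yangian.t a b d) (Φ x))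
    (y : Yangian n) (x : V) : Φ (π y x) = π' y (Φ x) := by
  obtain ⟨y, rfl⟩ := RingQuot.mkAlgHom_surjective ℂ (YRel n) y
  induction y using FreeAlgebra.induction generalizing x with
  | grade0 c => simp
  | grade1 g => exact h g.1 g.2.1 g.2.2 x
  | mul a b ha hb => simp [ha, hb]
  | add a b ha hb => simp [ha, hb]

lemma off_add_le {r : ℕ} (L : Fin r → ℕ) {k k' : Fin r} (h : k < k') :
    off L k + L k ≤ off L k' := by
  rw [off, off, add_comm, ← Finset.sum_insert (by simp)]
  refine Finset.sum_le_sum_of_subset fun j hj => ?_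
  simp only [Finset.mem_insert, Finset.mem_filter, Finset.mem_univ, true_and] at hj ⊢
  rcases hj with rfl | hj
  · exact h
  · exact hj.trans h

lemma off_eq_sum {r : ℕ} (L : Fin r → ℕ) (k : Fin r) :
    off L k = ∑ i : Fin k, L (Fin.castLE k.2.le i) := by
  rw [off]
  symm
  refine Finset.sum_bij (fun i _ => Fin.castLE k.2.le i) ?_ ?_ ?_ ?_
  · intro i _
    exact Finset.mem_filter.2 ⟨Finset.mem_univ _, i.2⟩
  · intro i _ j _ h
    simpa [Fin.ext_iff] using h
  · intro j hj
    simp only [Finset.mem_filter, Finset.mem_univ, true_and] at hj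
    exact ⟨⟨j, hj⟩, Finset.mem_univ _, rfl⟩
  · intro i _
    rfl

/-- Extension by zero of a function on `{0, …, r - 1}`. -/
def extendZero {R : Type} [Zero R] {r : ℕ} (f : Fin r → R) (k : ℕ) : R :=
  if h : k < r then f ⟨k, h⟩ else 0

lemma extendZero_val {R : Type} [Zero R] {r : ℕ} (f : Fin r → R) (k : Fin r) :
    extendZero f k = f k := by
  simp [extendZero]

/-- The `m`-th position is the `col m`-th one of the `row m`-th block. -/
def CellLabelling.IsStandard {r ℓ : ℕ} {L : Fin r → ℕ}
    (Λ : CellLabelling (Fin ℓ) r (extendZero L)) : Prop :=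
  ∀ m, ∃ k : Fin r, (k : ℕ) = Λ.row m ∧ (m : ℕ) = off L k + Λ.col m

lemma exists_cellLabelling {r ℓ : ℕ} {L : Fin r → ℕ} (hL : ∑ i, L i = ℓ) :
    ∃ Λ : CellLabelling (Fin ℓ) r (extendZero L), Λ.IsStandard := by
  subst hL
  refine ⟨⟨fun m => (finSigmaFinEquiv.symm m).1, fun m => (finSigmaFinEquiv.symm m).2,
    fun m => (finSigmaFinEquiv.symm m).1.2, fun m => ?_, ?_, ?_⟩, ?_⟩
  · rw [extendZero_val]
    exact (finSigmaFinEquiv.symm m).2.2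
  · intro m m' h1 h2
    apply finSigmaFinEquiv.symm.injective
    generalize finSigmaFinEquiv.symm m = x at h1 h2
    generalize finSigmaFinEquiv.symm m' = x' at h1 h2
    obtain ⟨k, c⟩ := x
    obtain ⟨k', c'⟩ := x'
    obtain rfl : k = k' := Fin.ext h1
    obtain rfl : c = c' := Fin.ext h2
    rfl
  · intro k hk c hc
    have hc' : c < L ⟨k, hk⟩ := by simpa [extendZero, hk] using hc
    refine ⟨finSigmaFinEquiv ⟨⟨k, hk⟩, ⟨c, hc'⟩⟩, ?_, ?_⟩ <;> rw [Equiv.symm_apply_apply]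
  · intro m
    refine ⟨(finSigmaFinEquiv.symm m).1, rfl, ?_⟩
    conv_lhs => rw [← finSigmaFinEquiv.apply_symm_apply m]
    rw [finSigmaFinEquiv_apply, off_eq_sum]

namespace CellLabelling

variable {r ℓ : ℕ} {L : Fin r → ℕ} {Λ : CellLabelling (Fin ℓ) r (extendZero L)}

lemma IsStandard.lt_iff (hΛ : Λ.IsStandard) (i m : Fin ℓ) :
    i < m ↔ Λ.row i < Λ.row m ∨ Λ.row i = Λ.row m ∧ Λ.col i < Λ.col m := by
  have key : ∀ i m, Λ.row i < Λ.row m → (i : ℕ) < m := by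
    intro i m h
    obtain ⟨k, hk, hi⟩ := hΛ i
    obtain ⟨k', hk', hm⟩ := hΛ m
    have h1 := off_add_le L (k := k) (k' := k') (by rw [Fin.lt_def]; omega)
    have h2 := Λ.col_lt i
    rw [← hk, extendZero_val] at h2
    omega
  have key' : Λ.row i = Λ.row m → ((i : ℕ) < m ↔ Λ.col i < Λ.col m) := by
    intro h
    obtain ⟨k, hk, hi⟩ := hΛ i
    obtain ⟨k', hk', hm⟩ := hΛ m
    obtain rfl : k = k' := Fin.ext (by omega)
    omega
  rw [Fin.lt_def]
  rcases lt_trichotomy (Λ.row i) (Λ.row m) with h | h | h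
  · simp [h, key i m h]
  · simp [h, key' h]
  · have := key m i h
    omega

variable {M : Type} [AddCommGroup M] [Module ℂ M] {T : EquivariantAction (Fin ℓ) M}

lemma IsStandard.s_apply (hΛ : Λ.IsStandard) {v : M}
    (h : ∀ m m' : Fin ℓ, (m' : ℕ) = m + 1 → Λ.row m = Λ.row m' → T.s m m' v = v)
    (m m' : Fin ℓ) (hm : Λ.row m = Λ.row m') : T.s m m' v = v := by
  have key : ∀ d, ∀ m m', Λ.row m = Λ.row m' → Λ.col m' = Λ.col m + d → T.s m m' v = v := by
    intro d
    induction d with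
    | zero =>
      intro m m' h1 h2
      rw [Λ.injective m m' h1 h2.symm, T.s_self]
    | succ d ih =>
      intro m m' h1 h2
      obtain ⟨m₁, h3, h4⟩ := Λ.surjective (Λ.row m') (Λ.row_lt m') (Λ.col m + d) (by
        have := Λ.col_lt m'
        omega)
      have h5 : T.s m₁ m' v = v := by
        refine h m₁ m' ?_ h3
        obtain ⟨k, hk, hi⟩ := hΛ m₁
        obtain ⟨k', hk', hm⟩ := hΛ m'
        obtain rfl : k = k' := Fin.ext (by omega)
        omega
      have h6 := ih m m₁ (h1.trans h3.symm) h4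
      by_cases hd : m = m₁
      · rw [hd, h5]
      · have hm' : m ≠ m' := by
          rintro rfl
          omega
        have h7 := T.s_conj m₁ m' m m₁ v
        rw [h6, h5, Equiv.swap_apply_of_ne_of_ne hd hm', Equiv.swap_apply_left] at h7
        exact h7.symm
  rcases le_total (Λ.col m) (Λ.col m') with h1 | h1
  · exact key (Λ.col m' - Λ.col m) m m' hm (by omega)
  · rw [T.s_symm]
    exact key (Λ.col m - Λ.col m') m' m hm.symm (by omega)

end CellLabelling

/-- The generator of a quotient of a standard module. -/
structure IsStandardVector {r ℓ : ℕ} {L : Fin r → ℕ} (μ : Fin r → ℂ) {M : Type} [AddCommGroup M]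
    [Module ℂ M] (ρ : Hecke ℓ →ₐ[ℂ] Module.End ℂ M)
    (Λ : CellLabelling (Fin ℓ) r (extendZero L)) (u : M) : Prop where
  eps : ∀ m, ρ (Hecke.eps m) u = (extendZero μ (Λ.row m) + Λ.col m) • u
  symm : ∀ m m', Λ.row m = Λ.row m' → ρ (Hecke.sigma (Equiv.swap m m')) u = u

lemma isStandardVector_of_quotient {r ℓ : ℕ} {L : Fin r → ℕ} {μ : Fin r → ℂ} {M : Type}
    [AddCommGroup M] [Module ℂ M] {ρ : Hecke ℓ →ₐ[ℂ] Module.End ℂ M}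
    {φ : KMod ℓ L μ →ₗ[ℂ] M}
    (hφ : ∀ (h : Hecke ℓ) (x : KMod ℓ L μ), φ (quotRho (KIdeal ℓ L μ) h x) = ρ h (φ x))
    {Λ : CellLabelling (Fin ℓ) r (extendZero L)} (hΛ : Λ.IsStandard) :
    IsStandardVector μ ρ Λ (φ (Submodule.Quotient.mk 1)) := by
  have hmk : ∀ h : Hecke ℓ, h ∈ KIdeal ℓ L μ → ρ h (φ (Submodule.Quotient.mk 1)) = 0 := by
    intro h hh
    rw [← hφ]
    have : quotRho (KIdeal ℓ L μ) h (Submodule.Quotient.mk 1) =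
        Submodule.Quotient.mk (h * 1) := rfl
    rw [this, mul_one, (Submodule.Quotient.mk_eq_zero _).2 hh, map_zero]
  have hblock : ∀ m, ∃ k : Fin r, (k : ℕ) = Λ.row m ∧ inBlock L k (m : ℕ) ∧
      (m : ℕ) = off L k + Λ.col m := by
    intro m
    obtain ⟨k, hk, hm⟩ := hΛ m
    have := Λ.col_lt m
    rw [← hk, extendZero_val] at this
    exact ⟨k, hk, ⟨by omega, by omega⟩, hm⟩
  refine ⟨fun m => ?_, ?_⟩
  · obtain ⟨k, hk, hb, hm⟩ := hblock m
    have := hmk _ (Submodule.subset_span (Or.inl ⟨m, k, hb, rfl⟩))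
    rw [map_sub, map_smul, map_one, LinearMap.sub_apply, sub_eq_zero] at this
    rw [this, ← hk, extendZero_val, LinearMap.smul_apply, Module.End.one_apply]
    congr 3
    omega
  · refine hΛ.s_apply (T := Hecke.toEquivariantAction ρ) fun m m' hm' hrow => ?_
    obtain ⟨k, hk, hb, hm⟩ := hblock m
    obtain ⟨k', hk', hb', -⟩ := hblock m'
    obtain rfl : k = k' := Fin.ext (by omega)
    have := hmk _ (Submodule.subset_span (Or.inr ⟨m, m', k, hm', hb, hb', rfl⟩))
    rwa [map_sub, map_one, LinearMap.sub_apply, sub_eq_zero] at this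

lemma IsStandardVector.eta_apply {r ℓ : ℕ} {L : Fin r → ℕ} {μ : Fin r → ℂ} {M : Type}
    [AddCommGroup M] [Module ℂ M] {ρ : Hecke ℓ →ₐ[ℂ] Module.End ℂ M}
    {Λ : CellLabelling (Fin ℓ) r (extendZero L)} {u : M} (hu : IsStandardVector μ ρ Λ u)
    (hΛ : Λ.IsStandard) (m : Fin ℓ) :
    (Hecke.toEquivariantAction ρ).eta m (Finset.univ.filter fun i => Λ.row i < Λ.row m) u =
      extendZero μ (Λ.row m) • u := by
  have h1 := hu.eps m
  have hset : Finset.univ.filter (fun i : Fin ℓ => i < m) =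
      (Finset.univ.filter fun i => Λ.row i < Λ.row m) ∪
        Finset.univ.filter fun i => Λ.row i = Λ.row m ∧ Λ.col i < Λ.col m := by
    ext i
    simp [hΛ.lt_iff]
  have hdisj : Disjoint (Finset.univ.filter fun i => Λ.row i < Λ.row m)
      (Finset.univ.filter fun i => Λ.row i = Λ.row m ∧ Λ.col i < Λ.col m) := by
    rw [Finset.disjoint_left]
    intro i hi hi'
    rw [Finset.mem_filter] at hi hi'
    omega
  have hcard : (Finset.univ.filter fun i => Λ.row i = Λ.row m ∧ Λ.col i < Λ.col m).card =
      Λ.col m := by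
    refine Eq.trans ?_ (Finset.card_range (Λ.col m))
    rw [← Finset.card_image_of_injOn (f := Λ.col)]
    · congr 1
      ext c
      simp only [Finset.mem_image, Finset.mem_filter, Finset.mem_univ, true_and, Finset.mem_range]
      constructor
      · rintro ⟨i, hi, rfl⟩
        exact hi.2
      · intro hc
        obtain ⟨i, hi, rfl⟩ := Λ.surjective (Λ.row m) (Λ.row_lt m) c (hc.trans (Λ.col_lt m))
        exact ⟨i, ⟨hi, hc⟩, rfl⟩
    · intro i hi i' hi' h
      rw [Finset.mem_coe, Finset.mem_filter] at hi hi'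
      exact Λ.injective i i' (hi.2.1.trans hi'.2.1.symm) h
  rw [Hecke.eps_eq, map_add, map_sum, hset, Finset.sum_union hdisj, ← add_assoc,
    LinearMap.add_apply, add_smul] at h1
  have h2 : (∑ i ∈ Finset.univ.filter fun i => Λ.row i = Λ.row m ∧ Λ.col i < Λ.col m,
      ρ (Hecke.sigma (Equiv.swap i m))) u = (Λ.col m : ℂ) • u := by
    rw [LinearMap.sum_apply, Finset.sum_congr rfl fun i hi =>
      hu.symm i m (Finset.mem_filter.1 hi).2.1, Finset.sum_const, hcard, Nat.cast_smul_eq_nsmul]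
  rw [h2] at h1
  exact add_right_cancel h1

/-- The sign of a permutation as a complex number. -/
def signC {X : Type} [DecidableEq X] [Fintype X] (σ : Equiv.Perm X) : ℂ :=
  ((Equiv.Perm.sign σ : ℤ) : ℂ)

section signC

variable {X : Type} [DecidableEq X] [Fintype X]

lemma signC_one : signC (1 : Equiv.Perm X) = 1 := by simp [signC]

lemma signC_mul (σ τ : Equiv.Perm X) : signC (σ * τ) = signC σ * signC τ := by simp [signC]

lemma signC_swap {a b : X} (h : a ≠ b) : signC (Equiv.swap a b) = -1 := by
  simp [signC, Equiv.Perm.sign_swap h]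

lemma signC_mul_self (σ : Equiv.Perm X) : signC σ * signC σ = 1 := by
  rcases Int.units_eq_one_or (Equiv.Perm.sign σ) with h | h <;> simp [signC, h]

lemma signC_ne_zero (σ : Equiv.Perm X) : signC σ ≠ 0 :=
  left_ne_zero_of_mul_eq_one (signC_mul_self σ)

lemma signC_smul_signC_smul {V : Type} [AddCommGroup V] [Module ℂ V] (σ : Equiv.Perm X) (v : V) :
    signC σ • signC σ • v = v := by
  rw [smul_smul, signC_mul_self, one_smul]

/-- A vector which is antisymmetric under the transpositions preserving `col` is antisymmetric
under all permutations preserving `col`. -/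
lemma EquivariantAction.S_apply_of_antisymm {M : Type} [AddCommGroup M] [Module ℂ M]
    (T : EquivariantAction X M) {Y : Type} {col : X → Y} {v : M}
    (h : ∀ a b, a ≠ b → col a = col b → T.s a b v = -v) (σ : Equiv.Perm X)
    (hσ : ∀ m, col (σ m) = col m) : T.S σ v = signC σ • v := by
  induction hk : σ.support.card using Nat.strong_induction_on generalizing σ with
  | _ k ih =>
    by_cases hσ1 : σ = 1
    · rw [hσ1, map_one, signC_one, one_smul, Module.End.one_apply]
    · obtain ⟨x, hx⟩ : ∃ x, σ x ≠ x := by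
        by_contra! hx
        exact hσ1 (Equiv.ext hx)
      have h1 := ih _ (hk ▸ Equiv.Perm.card_support_swap_mul hx) (Equiv.swap x (σ x) * σ) (by
        intro m
        rw [Equiv.Perm.mul_apply, Equiv.swap_apply_def]
        split_ifs with h2 h3
        · rw [hσ x, ← hσ m, h2]
        · rw [← hσ x, ← hσ m, h3]
        · exact hσ m) rfl
      have h2 : σ = Equiv.swap x (σ x) * (Equiv.swap x (σ x) * σ) := by
        rw [← mul_assoc, Equiv.swap_mul_self, one_mul]
      have h3 := h x (σ x) hx.symm (hσ x).symm
      rw [EquivariantAction.s] at h3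
      conv_lhs => rw [h2]
      conv_rhs => rw [h2]
      rw [map_mul, Module.End.mul_apply, h1, map_smul, h3,
        signC_mul (Equiv.swap x (σ x)) (Equiv.swap x (σ x) * σ), signC_swap hx.symm, neg_one_mul,
        smul_neg, neg_smul]

end signC

section twist

variable {ℓ : ℕ} {M : Type} [AddCommGroup M] [Module ℂ M] (n : ℕ)
  (ρ : Hecke ℓ →ₐ[ℂ] Module.End ℂ M)

/-- The diagonal action of `σ ∈ W_ℓ` on `M ⊗ (ℂ^n)^{⊗ℓ}`. -/
def twist (σ : Equiv.Perm (Fin ℓ)) : MW ℓ n M →ₗ[ℂ] MW ℓ n M :=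
  hOp n ρ (Hecke.sigma σ) ∘ₗ permOp n σ

variable {n ρ}

lemma twist_apply (σ : Equiv.Perm (Fin ℓ)) (f : MW ℓ n M) (w : Word ℓ n) :
    twist n ρ σ f w = ρ (Hecke.sigma σ) (f (w ∘ σ)) := rfl

lemma twist_mul (σ τ : Equiv.Perm (Fin ℓ)) (f : MW ℓ n M) :
    twist n ρ (σ * τ) f = twist n ρ σ (twist n ρ τ f) := by
  funext w
  rw [twist_apply, twist_apply, twist_apply, Hecke.sigma_mul, map_mul, Module.End.mul_apply]
  rfl

lemma twist_one (f : MW ℓ n M) : twist n ρ 1 f = f := by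
  funext w
  rw [twist_apply, Hecke.sigma_one, map_one]
  rfl

lemma twist_single (σ : Equiv.Perm (Fin ℓ)) (w : Word ℓ n) (x : M) :
    twist n ρ σ (Pi.single (w ∘ σ) x) = Pi.single w (ρ (Hecke.sigma σ) x) := by
  funext w'
  rw [twist_apply]
  by_cases h : w' = w
  · rw [h, Pi.single_eq_same, Pi.single_eq_same]
  · rw [Pi.single_eq_of_ne h, Pi.single_eq_of_ne, map_zero]
    exact fun h' => h (σ.surjective.injective_comp_right h')

lemma mk_twist (σ : Equiv.Perm (Fin ℓ)) (f : MW ℓ n M) :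
    (Submodule.Quotient.mk (twist n ρ σ f) : Dmod n ρ) = signC σ • Submodule.Quotient.mk f := by
  induction σ using Equiv.Perm.adjacent_induction generalizing f with
  | one => rw [twist_one, signC_one, one_smul]
  | mul w w' hw hw' => rw [twist_mul, hw, hw', signC_mul, smul_smul]
  | adj i h =>
    rw [signC_swap (fun h => by simpa using congrArg Fin.val h), neg_one_smul,
      ← sub_eq_zero, sub_neg_eq_add, ← Submodule.Quotient.mk_add, Submodule.Quotient.mk_eq_zero]
    exact Submodule.mem_iSup_of_mem i (Submodule.mem_iSup_of_mem h ⟨f, rfl⟩)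

variable (n ρ) in
/-- Antisymmetrization. -/
def antisymmetrize : MW ℓ n M →ₗ[ℂ] MW ℓ n M :=
  ∑ σ : Equiv.Perm (Fin ℓ), signC σ • twist n ρ σ

lemma antisymmetrize_apply (f : MW ℓ n M) :
    antisymmetrize n ρ f = ∑ σ : Equiv.Perm (Fin ℓ), signC σ • twist n ρ σ f := by
  simp [antisymmetrize, LinearMap.sum_apply]

lemma antisymmetrize_twist (τ : Equiv.Perm (Fin ℓ)) (f : MW ℓ n M) :
    antisymmetrize n ρ (twist n ρ τ f) = signC τ • antisymmetrize n ρ f := by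
  rw [antisymmetrize_apply, antisymmetrize_apply, Finset.smul_sum]
  refine Finset.sum_equiv (Equiv.mulRight τ) (by simp) fun σ _ => ?_
  rw [Equiv.coe_mulRight, twist_mul, signC_mul, smul_smul, mul_comm (signC σ), ← mul_assoc,
    signC_mul_self, one_mul]

lemma twist_antisymmetrize (τ : Equiv.Perm (Fin ℓ)) (f : MW ℓ n M) :
    twist n ρ τ (antisymmetrize n ρ f) = signC τ • antisymmetrize n ρ f := by
  rw [antisymmetrize_apply, map_sum, Finset.smul_sum]
  refine Finset.sum_equiv (Equiv.mulLeft τ) (by simp) fun σ _ => ?_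
  rw [Equiv.coe_mulLeft, map_smul, ← twist_mul, signC_mul, smul_smul, ← mul_assoc,
    signC_mul_self, one_mul]

lemma antisymmetrize_eq_zero {f : MW ℓ n M} (h : (Submodule.Quotient.mk f : Dmod n ρ) = 0) :
    antisymmetrize n ρ f = 0 := by
  rw [Submodule.Quotient.mk_eq_zero] at h
  have : NSub n ρ ≤ LinearMap.ker (antisymmetrize n ρ) := by
    refine iSup_le fun i => iSup_le fun hi => ?_
    rintro _ ⟨g, rfl⟩
    rw [LinearMap.mem_ker]
    change antisymmetrize n ρ (twist n ρ _ g + g) = 0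
    rw [map_add, antisymmetrize_twist, signC_swap (fun h => by simpa using congrArg Fin.val h),
      neg_one_smul, neg_add_cancel]
  exact this h

lemma mk_antisymmetrize (f : MW ℓ n M) :
    (Submodule.Quotient.mk (antisymmetrize n ρ f) : Dmod n ρ) =
      (Fintype.card (Equiv.Perm (Fin ℓ)) : ℂ) • Submodule.Quotient.mk f := by
  rw [antisymmetrize_apply, ← Submodule.mkQ_apply, map_sum]
  simp only [map_smul, Submodule.mkQ_apply, mk_twist, signC_smul_signC_smul]
  rw [Finset.sum_const, Nat.cast_smul_eq_nsmul, Finset.card_univ]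

lemma nontrivial_dmod {col : Fin ℓ → Fin n} {v : M} (hv : v ≠ 0)
    (h : ∀ a b, a ≠ b → col a = col b → ρ (Hecke.sigma (Equiv.swap a b)) v = -v) :
    Nontrivial (Dmod n ρ) := by
  refine ⟨Submodule.Quotient.mk (Pi.single col v), 0, fun h0 => ?_⟩
  have h1 := congrFun (antisymmetrize_eq_zero h0) col
  rw [antisymmetrize_apply, Finset.sum_apply] at h1
  have h2 : ∀ σ : Equiv.Perm (Fin ℓ), (signC σ • twist n ρ σ (Pi.single col v)) col =
      if col ∘ σ = col then v else 0 := by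
    intro σ
    rw [Pi.smul_apply, twist_apply]
    split_ifs with hσ
    · have := (Hecke.toEquivariantAction ρ).S_apply_of_antisymm h σ (congrFun hσ)
      rw [hσ, Pi.single_eq_same]
      change signC σ • (Hecke.toEquivariantAction ρ).S σ v = v
      rw [this, signC_smul_signC_smul]
    · rw [Pi.single_eq_of_ne hσ, map_zero, smul_zero]
  rw [Finset.sum_congr rfl fun σ _ => h2 σ, ← Finset.sum_filter, Finset.sum_const,
    ← Nat.cast_smul_eq_nsmul ℂ, Pi.zero_apply, smul_eq_zero, Nat.cast_eq_zero,
    Finset.card_eq_zero] at h1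
  rcases h1 with h1 | h1
  · have : (1 : Equiv.Perm (Fin ℓ)) ∈ Finset.univ.filter
        fun σ : Equiv.Perm (Fin ℓ) => col ∘ σ = col := by simp
    rw [h1] at this
    simp at this
  · exact hv h1

end twist

lemma IsStandardVector.span_eq_top {r ℓ : ℕ} {L : Fin r → ℕ} {μ : Fin r → ℂ} {M : Type}
    [AddCommGroup M] [Module ℂ M] {ρ : Hecke ℓ →ₐ[ℂ] Module.End ℂ M} (hρ : HSimple ρ)
    {Λ : CellLabelling (Fin ℓ) r (extendZero L)} {u : M} (hu : IsStandardVector μ ρ Λ u)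
    (hu0 : u ≠ 0) :
    Submodule.span ℂ (Set.range fun σ => ρ (Hecke.sigma σ) u) = ⊤ := by
  have hσ : ∀ w, ∀ x ∈ Submodule.span ℂ (Set.range fun σ => ρ (Hecke.sigma σ) u),
      ρ (Hecke.sigma w) x ∈ Submodule.span ℂ (Set.range fun σ => ρ (Hecke.sigma σ) u) := by
    intro w x hx
    induction hx using Submodule.span_induction with
    | mem x hx =>
      obtain ⟨σ, rfl⟩ := hx
      refine Submodule.subset_span ⟨w * σ, ?_⟩
      simp only [Hecke.sigma_mul, map_mul, Module.End.mul_apply]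
    | zero => simp
    | add x y _ _ hx hy => simpa using Submodule.add_mem _ hx hy
    | smul c x _ hx => simpa using Submodule.smul_mem _ c hx
  have hmem : ∀ w, ρ (Hecke.sigma w) u ∈
      Submodule.span ℂ (Set.range fun σ => ρ (Hecke.sigma σ) u) :=
    fun w => Submodule.subset_span ⟨w, rfl⟩
  have hu1 : u ∈ Submodule.span ℂ (Set.range fun σ => ρ (Hecke.sigma σ) u) := by
    simpa [Hecke.sigma_one] using hmem 1
  have hy : ∀ m, ρ (Hecke.y m) u ∈
      Submodule.span ℂ (Set.range fun σ => ρ (Hecke.sigma σ) u) := by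
    intro m
    rw [Hecke.y, map_sub, map_sum, LinearMap.sub_apply, LinearMap.sum_apply, hu.eps]
    exact Submodule.sub_mem _ (Submodule.smul_mem _ _ hu1) (Submodule.sum_mem _ fun j _ => hmem _)
  refine (hρ.2 _ (Hecke.hStable_of_sigma_of_y hσ fun m x hx => ?_)).resolve_left ?_
  · induction hx using Submodule.span_induction with
    | mem x hx =>
      obtain ⟨σ, rfl⟩ := hx
      have h1 := Hecke.sigma_mul_y σ (σ⁻¹ m)
      have h2 : σ (σ⁻¹ m) = m := σ.apply_symm_apply m
      simp only
      rw [h2] at h1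
      rw [← Module.End.mul_apply, ← map_mul, ← h1, map_mul, Module.End.mul_apply]
      exact hσ σ _ (hy _)
    | zero => simp
    | add x y _ _ hx hy => simpa using Submodule.add_mem _ hx hy
    | smul c x _ hx => simpa using Submodule.smul_mem _ c hx
  · intro h
    rw [h, Submodule.mem_bot] at hu1
    exact hu0 hu1

/-- The Drinfeld functor kills the simple quotients of a standard module with a row longer
than `n`. -/
lemma IsStandardVector.subsingleton_dmod {n r ℓ : ℕ} {L : Fin r → ℕ} {μ : Fin r → ℂ} {M : Type}
    [AddCommGroup M] [Module ℂ M] {ρ : Hecke ℓ →ₐ[ℂ] Module.End ℂ M} (hρ : HSimple ρ)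
    {Λ : CellLabelling (Fin ℓ) r (extendZero L)} {u : M} (hu : IsStandardVector μ ρ Λ u)
    (hu0 : u ≠ 0) {k : Fin r} (hk : n < L k) : Subsingleton (Dmod n ρ) := by
  have h1 : ∀ w : Word ℓ n, (Submodule.Quotient.mk (Pi.single w u) : Dmod n ρ) = 0 := by
    intro w
    have hcell : ∀ i : Fin (L k), ∃ m, Λ.row m = k ∧ Λ.col m = i := fun i =>
      Λ.surjective k k.2 i (by rw [extendZero_val]; exact i.2)
    choose c hc using hcell
    obtain ⟨i, j, hij, hw⟩ := Fintype.exists_ne_map_eq_of_card_lt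
      (fun i : Fin (L k) => w (c i)) (by simpa using hk)
    have hcij : c i ≠ c j := by
      intro h
      have := (hc j).2
      rw [← h, (hc i).2] at this
      exact hij (Fin.ext this)
    have hws : w ∘ Equiv.swap (c i) (c j) = w := by
      funext m
      rw [Function.comp_apply, Equiv.swap_apply_def]
      split_ifs with h2 h3
      · rw [h2]
        exact hw.symm
      · rw [h3]
        exact hw
      · rfl
    have h2 := twist_single (ρ := ρ) (Equiv.swap (c i) (c j)) w u
    rw [hws, hu.symm _ _ ((hc i).1.trans (hc j).1.symm)] at h2
    have h3 := mk_twist (ρ := ρ) (Equiv.swap (c i) (c j)) (Pi.single w u)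
    rw [h2, signC_swap hcij, neg_one_smul] at h3
    rw [eq_neg_iff_add_eq_zero, ← two_smul ℂ] at h3
    exact (smul_eq_zero.1 h3).resolve_left two_ne_zero
  have h2 : ∀ (w : Word ℓ n) (x : M), (Submodule.Quotient.mk (Pi.single w x) : Dmod n ρ) = 0 := by
    intro w x
    have hx : x ∈ Submodule.span ℂ (Set.range fun σ => ρ (Hecke.sigma σ) u) := by
      rw [hu.span_eq_top hρ hu0]
      trivial
    induction hx using Submodule.span_induction with
    | mem x hx =>
      obtain ⟨σ, rfl⟩ := hx
      simp only
      rw [← twist_single, mk_twist, h1, smul_zero]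
    | zero => rw [Pi.single_zero, Submodule.Quotient.mk_zero]
    | add x y _ _ hx hy => rw [Pi.single_add, Submodule.Quotient.mk_add, hx, hy, add_zero]
    | smul c x _ hx => rw [Pi.single_smul, Submodule.Quotient.mk_smul, hx, smul_zero]
  refine subsingleton_of_forall_eq 0 fun x => ?_
  obtain ⟨f, rfl⟩ := Submodule.Quotient.mk_surjective _ x
  rw [← Finset.univ_sum_single f, ← Submodule.mkQ_apply, map_sum]
  exact Finset.sum_eq_zero fun w _ => h2 w _

/-- The product `y_{m_1} y_{m_2} ⋯` along a list. -/
def Hecke.yWord {ℓ : ℕ} (l : List (Fin ℓ)) : Hecke ℓ := (l.map Hecke.y).prod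

namespace Hecke

variable {ℓ : ℕ}

lemma yWord_cons (m : Fin ℓ) (l : List (Fin ℓ)) : yWord (m :: l) = y m * yWord l := by
  simp [yWord]

lemma yWord_append (l l' : List (Fin ℓ)) : yWord (l ++ l') = yWord l * yWord l' := by
  simp [yWord]

lemma yWord_replicate (d : ℕ) (m : Fin ℓ) : yWord (List.replicate d m) = y m ^ d := by
  simp [yWord]

lemma sigma_mul_yWord (w : Equiv.Perm (Fin ℓ)) (l : List (Fin ℓ)) :
    sigma w * yWord l = yWord (l.map w) * sigma w := by
  induction l with
  | nil => simp [yWord]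
  | cons m l ih =>
    rw [List.map_cons, yWord_cons, yWord_cons, ← mul_assoc, sigma_mul_y, mul_assoc, ih, mul_assoc]

lemma yWord_swap {a b : Fin ℓ} (hab : a ≠ b) (p l : List (Fin ℓ)) :
    yWord (p ++ a :: b :: l) = yWord (p ++ b :: a :: l) +
      (yWord (p ++ b :: l.map (Equiv.swap a b)) - yWord (p ++ a :: l.map (Equiv.swap a b))) *
        sigma (Equiv.swap a b) := by
  have h := y_bracket hab
  rw [sub_eq_iff_eq_add'] at h
  simp only [yWord_append, yWord_cons, ← mul_sub, ← sub_mul, mul_assoc, ← sigma_mul_yWord,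
    ← mul_add]
  congr 1
  simp only [← mul_assoc, ← add_mul, h]

end Hecke

section matrixUnit

variable {ℓ n : ℕ} {M : Type} [AddCommGroup M] [Module ℂ M] {ρ : Hecke ℓ →ₐ[ℂ] Module.End ℂ M}

/-- The product of the matrix units `E_{α_m β_m}` acting on the tensor factors `m ∈ I`. -/
def matrixUnitOp (I : Finset (Fin ℓ)) (α β : Word ℓ n) (f : MW ℓ n M) : MW ℓ n M :=
  fun w => if ∀ m ∈ I, w m = α m then f (I.piecewise β w) else 0

lemma hOp_apply (h : Hecke ℓ) (f : MW ℓ n M) (w : Word ℓ n) : hOp n ρ h f w = ρ h (f w) := rfl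

lemma hOp_mul (h h' : Hecke ℓ) (f : MW ℓ n M) :
    hOp n ρ (h * h') f = hOp n ρ h (hOp n ρ h' f) := by
  funext w
  rw [hOp_apply, map_mul]
  rfl

lemma tauOp_apply (m : Fin ℓ) (a b : Fin n) (f : MW ℓ n M) (w : Word ℓ n) :
    tauOp m a b f w = if w m = a then f (Function.update w m b) else 0 := rfl

lemma tauOp_hOp (m : Fin ℓ) (a b : Fin n) (h : Hecke ℓ) (f : MW ℓ n M) :
    tauOp m a b (hOp n ρ h f) = hOp n ρ h (tauOp m a b f) := by
  funext w
  rw [hOp_apply, tauOp_apply, tauOp_apply, apply_ite (ρ h), map_zero]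
  rfl

lemma twist_tauOp (σ : Equiv.Perm (Fin ℓ)) (m : Fin ℓ) (a b : Fin n) (f : MW ℓ n M) :
    twist n ρ σ (tauOp m a b f) = tauOp (σ m) a b (twist n ρ σ f) := by
  funext w
  rw [twist_apply, tauOp_apply, tauOp_apply, apply_ite (ρ (Hecke.sigma σ)), map_zero, twist_apply,
    Function.update_comp_eq_of_injective _ σ.injective]
  rfl

lemma twist_hOp {σ : Equiv.Perm (Fin ℓ)} {h h' : Hecke ℓ}
    (hσ : Hecke.sigma σ * h = h' * Hecke.sigma σ) (f : MW ℓ n M) :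
    twist n ρ σ (hOp n ρ h f) = hOp n ρ h' (twist n ρ σ f) := by
  funext w
  rw [twist_apply, hOp_apply, hOp_apply, twist_apply, ← Module.End.mul_apply, ← map_mul, hσ,
    map_mul, Module.End.mul_apply]

lemma twist_matrixUnitOp {σ : Equiv.Perm (Fin ℓ)} {I : Finset (Fin ℓ)} (hσ : ∀ m ∈ I, σ m = m)
    (α β : Word ℓ n) (f : MW ℓ n M) :
    twist n ρ σ (matrixUnitOp I α β f) = matrixUnitOp I α β (twist n ρ σ f) := by
  funext w
  have h1 : (∀ m ∈ I, (w ∘ σ) m = α m) ↔ ∀ m ∈ I, w m = α m :=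
    forall₂_congr fun m hm => by rw [Function.comp_apply, hσ m hm]
  have h2 : I.piecewise β (w ∘ σ) = I.piecewise β w ∘ σ := by
    funext m
    by_cases hm : m ∈ I
    · rw [Finset.piecewise_eq_of_mem _ _ _ hm, Function.comp_apply, hσ m hm,
        Finset.piecewise_eq_of_mem _ _ _ hm]
    · have hm' : σ m ∉ I := fun h => hm (by rwa [← σ.injective (hσ _ h)])
      rw [Finset.piecewise_eq_of_notMem _ _ _ hm, Function.comp_apply, Function.comp_apply,
        Finset.piecewise_eq_of_notMem _ _ _ hm']
  rw [twist_apply, matrixUnitOp, matrixUnitOp, h2, apply_ite (ρ (Hecke.sigma σ)), map_zero,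
    twist_apply]
  exact if_congr h1 rfl rfl

lemma tauOp_matrixUnitOp_of_notMem {I : Finset (Fin ℓ)} {m : Fin ℓ} (hm : m ∉ I)
    (α β : Word ℓ n) (f : MW ℓ n M) :
    tauOp m (α m) (β m) (matrixUnitOp I α β f) = matrixUnitOp (insert m I) α β f := by
  funext w
  have hne : ∀ i ∈ I, i ≠ m := fun i hi h => hm (h ▸ hi)
  have h1 : (∀ i ∈ I, Function.update w m (β m) i = α i) ↔ ∀ i ∈ I, w i = α i :=
    forall₂_congr fun i hi => by rw [Function.update_of_ne (hne i hi)]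
  have h2 : I.piecewise β (Function.update w m (β m)) = (insert m I).piecewise β w := by
    funext i
    by_cases hi : i = m
    · rw [hi, Finset.piecewise_eq_of_notMem _ _ _ hm, Function.update_self,
        Finset.piecewise_eq_of_mem _ _ _ (Finset.mem_insert_self m I)]
    · by_cases hi' : i ∈ I
      · rw [Finset.piecewise_eq_of_mem _ _ _ hi',
          Finset.piecewise_eq_of_mem _ _ _ (Finset.mem_insert_of_mem hi')]
      · rw [Finset.piecewise_eq_of_notMem _ _ _ hi', Function.update_of_ne hi,
          Finset.piecewise_eq_of_notMem _ _ _ (by simp [hi, hi'])]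
  rw [tauOp_apply, matrixUnitOp, matrixUnitOp, ← ite_and, h2]
  refine if_congr ?_ rfl rfl
  rw [h1, Finset.forall_mem_insert]

lemma tauOp_matrixUnitOp_of_mem {I : Finset (Fin ℓ)} {m : Fin ℓ} (hm : m ∈ I)
    (a b : Fin n) (α β : Word ℓ n) (f : MW ℓ n M) :
    tauOp m a b (matrixUnitOp I α β f) =
      if b = α m then matrixUnitOp I (Function.update α m a) β f else 0 := by
  have h1 : ∀ w : Word ℓ n, I.piecewise β (Function.update w m b) = I.piecewise β w := by
    intro w
    funext i
    by_cases hi : i ∈ I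
    · rw [Finset.piecewise_eq_of_mem _ _ _ hi, Finset.piecewise_eq_of_mem _ _ _ hi]
    · have him : i ≠ m := by
        rintro rfl
        exact hi hm
      rw [Finset.piecewise_eq_of_notMem _ _ _ hi, Finset.piecewise_eq_of_notMem _ _ _ hi,
        Function.update_of_ne him]
  funext w
  rw [tauOp_apply, matrixUnitOp, ← ite_and, h1]
  split_ifs with h2 h3 h3
  · rw [matrixUnitOp, if_pos]
    intro i hi
    by_cases him : i = m
    · rw [him, Function.update_self, h2.1]
    · rw [Function.update_of_ne him, ← h2.2 i hi, Function.update_of_ne him]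
  · refine absurd ?_ h3
    rw [← h2.2 m hm, Function.update_self]
  · rw [matrixUnitOp, if_neg]
    intro h4
    refine h2 ⟨by rw [h4 m hm, Function.update_self], fun i hi => ?_⟩
    by_cases him : i = m
    · rw [him, Function.update_self, h3]
    · rw [Function.update_of_ne him, h4 i hi, Function.update_of_ne him]
  · rfl

lemma matrixUnitOp_empty (α β : Word ℓ n) (f : MW ℓ n M) : matrixUnitOp ∅ α β f = f := by
  funext w
  simp [matrixUnitOp]

lemma matrixUnitOp_univ (α β : Word ℓ n) (f : MW ℓ n M) :
    matrixUnitOp Finset.univ α β f = Pi.single α (f β) := by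
  funext w
  rw [matrixUnitOp, Finset.piecewise_univ]
  by_cases h : w = α
  · rw [h, Pi.single_eq_same, if_pos fun _ _ => rfl]
  · rw [Pi.single_eq_of_ne h, if_neg fun h' => h (funext fun m => h' m (Finset.mem_univ m))]

variable {f : MW ℓ n M}

lemma rho_sigma_apply_of_twist (hf : ∀ σ, twist n ρ σ f = signC σ • f) (σ : Equiv.Perm (Fin ℓ))
    (w : Word ℓ n) : ρ (Hecke.sigma σ) (f w) = signC σ • f (w ∘ σ.symm) := by
  have := congrFun (hf σ) (w ∘ σ.symm)
  rwa [twist_apply, Function.comp_assoc, Equiv.symm_comp_self, Function.comp_id] at this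

lemma hOp_sigma_swap_matrixUnitOp (hf : ∀ σ, twist n ρ σ f = signC σ • f) {I : Finset (Fin ℓ)}
    {a b : Fin ℓ} (ha : a ∈ I) (hb : b ∈ I) (hab : a ≠ b) (α β : Word ℓ n) :
    hOp n ρ (Hecke.sigma (Equiv.swap a b)) (matrixUnitOp I α β f) =
      -matrixUnitOp I α (β ∘ Equiv.swap a b) f := by
  funext w
  have h1 : I.piecewise β w ∘ Equiv.swap a b = I.piecewise (β ∘ Equiv.swap a b) w := by
    funext i
    by_cases hi : i ∈ I
    · rw [Function.comp_apply, Finset.piecewise_eq_of_mem _ _ _ hi, Finset.piecewise_eq_of_mem,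
        Function.comp_apply]
      rw [Equiv.swap_apply_def]
      split_ifs <;> assumption
    · have hia : i ≠ a := by
        rintro rfl
        exact hi ha
      have hib : i ≠ b := by
        rintro rfl
        exact hi hb
      rw [Function.comp_apply, Equiv.swap_apply_of_ne_of_ne hia hib,
        Finset.piecewise_eq_of_notMem _ _ _ hi,
        Finset.piecewise_eq_of_notMem _ _ _ hi]
  rw [hOp_apply, Pi.neg_apply, matrixUnitOp, matrixUnitOp]
  split_ifs
  · rw [rho_sigma_apply_of_twist hf, signC_swap hab, Equiv.symm_swap, h1, neg_one_smul]
  · rw [map_zero, neg_zero]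

variable {q : Submodule ℂ (Dmod n ρ)}

/-- Modulo words of smaller length, the order of the `y_m` does not matter. -/
lemma mk_yWord_mem_iff_of_perm (hf : ∀ σ, twist n ρ σ f = signC σ • f) {I : Finset (Fin ℓ)}
    {D : ℕ}
    (hD : ∀ l : List (Fin ℓ), l.length < D → (∀ m ∈ l, m ∈ I) → ∀ α β : Word ℓ n,
      Submodule.Quotient.mk (hOp n ρ (Hecke.yWord l) (matrixUnitOp I α β f)) ∈ q)
    {l l' : List (Fin ℓ)} (h : l.Perm l') : ∀ p : List (Fin ℓ), (p ++ l).length = D →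
    (∀ m ∈ p ++ l, m ∈ I) → ∀ α β : Word ℓ n,
      (Submodule.Quotient.mk (hOp n ρ (Hecke.yWord (p ++ l)) (matrixUnitOp I α β f)) ∈ q ↔
        Submodule.Quotient.mk (hOp n ρ (Hecke.yWord (p ++ l')) (matrixUnitOp I α β f)) ∈ q) := by
  induction h with
  | nil => intros; rfl
  | cons a _ ih =>
    intro p hp hpI α β
    have := ih (p ++ [a]) (by simpa using hp) (by simpa using hpI) α β
    simpa using this
  | swap a b l =>
    intro p hp hpI α β
    by_cases hab : b = a
    · rw [hab]
    have ha : a ∈ I := hpI a (by simp)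
    have hb : b ∈ I := hpI b (by simp)
    have hl : ∀ m ∈ l.map (Equiv.swap b a), m ∈ I := by
      intro m hm
      obtain ⟨i, hi, rfl⟩ := List.mem_map.1 hm
      have := hpI i (by simp [hi])
      rw [Equiv.swap_apply_def]
      split_ifs <;> assumption
    have hlen : ∀ c ∈ I,
        Submodule.Quotient.mk (hOp n ρ (Hecke.yWord (p ++ c :: l.map (Equiv.swap b a)))
          (matrixUnitOp I α (β ∘ Equiv.swap b a) f)) ∈ q := by
      intro c hc
      refine hD _ ?_ ?_ _ _
      · simp only [List.length_append, List.length_cons, List.length_map] at hp ⊢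
        omega
      · intro m hm
        rw [List.mem_append, List.mem_cons] at hm
        rcases hm with hm | rfl | hm
        · exact hpI m (by simp [hm])
        · exact hc
        · exact hl m hm
    rw [Hecke.yWord_swap hab]
    have h1 : ∀ (x y z s : Hecke ℓ) (g : MW ℓ n M), hOp n ρ (x + (y - z) * s) g =
        hOp n ρ x g + (hOp n ρ y (hOp n ρ s g) - hOp n ρ z (hOp n ρ s g)) := by
      intro x y z s g
      funext w
      simp only [hOp_apply, Pi.add_apply, Pi.sub_apply, map_add, map_sub, map_mul,
        LinearMap.add_apply, LinearMap.sub_apply, Module.End.mul_apply]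
    rw [h1, hOp_sigma_swap_matrixUnitOp hf hb ha hab, map_neg, map_neg, Submodule.Quotient.mk_add,
      Submodule.Quotient.mk_sub, Submodule.Quotient.mk_neg, Submodule.Quotient.mk_neg]
    exact q.add_mem_iff_left (q.sub_mem (q.neg_mem (hlen a ha)) (q.neg_mem (hlen b hb)))
  | trans h1 _ ih1 ih2 =>
    intro p hp hpI α β
    rw [ih1 p hp hpI]
    refine ih2 p ?_ ?_ α β
    · simpa [← h1.length_eq] using hp
    · simpa [← h1.mem_iff] using hpI

variable {π : Yangian n →ₐ[ℂ] Module.End ℂ (Dmod n ρ)}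

lemma mk_term_eq (hf : ∀ σ, twist n ρ σ f = signC σ • f) {I : Finset (Fin ℓ)} {m m₁ : Fin ℓ}
    (hm : m ∉ I) (hm₁ : m₁ ∉ I) {l : List (Fin ℓ)} (hl : ∀ i ∈ l, i ∈ I) (d : ℕ) (a b : Fin n)
    (α β : Word ℓ n) :
    (Submodule.Quotient.mk (hOp n ρ (Hecke.y m ^ d)
      (tauOp m a b (hOp n ρ (Hecke.yWord l) (matrixUnitOp I α β f)))) : Dmod n ρ) =
    Submodule.Quotient.mk (hOp n ρ (Hecke.y m₁ ^ d)
      (tauOp m₁ a b (hOp n ρ (Hecke.yWord l) (matrixUnitOp I α β f)))) := by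
  have hfix : ∀ i ∈ I, Equiv.swap m₁ m i = i := fun i hi =>
    Equiv.swap_apply_of_ne_of_ne (fun h => hm₁ (h ▸ hi)) (fun h => hm (h ▸ hi))
  have h1 : Hecke.sigma (Equiv.swap m₁ m) * Hecke.y m₁ ^ d =
      Hecke.y m ^ d * Hecke.sigma (Equiv.swap m₁ m) := by
    have := Hecke.sigma_mul_yWord (Equiv.swap m₁ m) (List.replicate d m₁)
    rwa [List.map_replicate, Equiv.swap_apply_left, Hecke.yWord_replicate,
      Hecke.yWord_replicate] at this
  have h2 : Hecke.sigma (Equiv.swap m₁ m) * Hecke.yWord l =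
      Hecke.yWord l * Hecke.sigma (Equiv.swap m₁ m) := by
    rw [Hecke.sigma_mul_yWord, List.map_congr_left fun i hi => hfix i (hl i hi), List.map_id']
  have h3 := mk_twist (ρ := ρ) (Equiv.swap m₁ m) (hOp n ρ (Hecke.y m₁ ^ d)
      (tauOp m₁ a b (hOp n ρ (Hecke.yWord l) (matrixUnitOp I α β f))))
  have h4 : matrixUnitOp I α β (signC (Equiv.swap m₁ m) • f) =
      signC (Equiv.swap m₁ m) • matrixUnitOp I α β f := by
    funext w
    rw [Pi.smul_apply, matrixUnitOp, matrixUnitOp, smul_ite, smul_zero]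
    rfl
  rw [twist_hOp h1, twist_tauOp, Equiv.swap_apply_left, twist_hOp h2, twist_matrixUnitOp hfix, hf,
    h4, map_smul, map_smul, map_smul, Submodule.Quotient.mk_smul] at h3
  exact smul_right_injective _ (signC_ne_zero _) h3

/-- A `Y(gl_n)`-submodule containing the class of an antisymmetric `f` contains the classes of all
the vectors obtained from `f` by acting with matrix units and with the corresponding `y_m`. -/
lemma mk_yWord_matrixUnitOp_mem (hπ : IsDrinfeldAction n ρ π) (hq : YStable π q)
    (hf : ∀ σ, twist n ρ σ f = signC σ • f) (hfq : Submodule.Quotient.mk f ∈ q) (k : ℕ) :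
    ∀ I : Finset (Fin ℓ), I.card = k → ∀ l : List (Fin ℓ), (∀ m ∈ l, m ∈ I) → ∀ α β : Word ℓ n,
      Submodule.Quotient.mk (hOp n ρ (Hecke.yWord l) (matrixUnitOp I α β f)) ∈ q := by
  induction k with
  | zero =>
    intro I hI l hl α β
    rw [Finset.card_eq_zero] at hI
    subst hI
    obtain rfl : l = [] := List.eq_nil_iff_forall_not_mem.2 fun m hm => by simpa using hl m hm
    rw [matrixUnitOp_empty]
    convert hfq
    funext w
    simp [hOp_apply, Hecke.yWord]
  | succ k ih =>
    intro I hI l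
    induction hD : l.length using Nat.strong_induction_on generalizing l with
    | _ D ihD =>
    intro hl α β
    obtain ⟨m₁, hm₁⟩ : I.Nonempty := Finset.card_pos.1 (by omega)
    have hI' := Finset.card_erase_of_mem hm₁
    have hperm : l.Perm (List.replicate (l.count m₁) m₁ ++ l.filter (fun i => i ≠ m₁)) := by
      rw [List.perm_iff_count]
      intro i
      rw [List.count_append, List.count_replicate]
      by_cases hi : i = m₁
      · subst hi
        simp [List.count_eq_zero]
      · rw [List.count_filter (by simpa using hi)]
        simp [Ne.symm hi]
    have hl'' : ∀ i ∈ l.filter (fun i => i ≠ m₁), i ∈ I.erase m₁ := by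
      intro i hi
      rw [List.mem_filter, decide_eq_true_eq] at hi
      exact Finset.mem_erase.2 ⟨hi.2, hl i hi.1⟩
    generalize l.count m₁ = d at hperm
    generalize l.filter (fun i => i ≠ m₁) = l'' at hperm hl''
    have h0 := mk_yWord_mem_iff_of_perm hf
      (fun l' hl' hl'I α β => ihD l'.length hl' l' rfl hl'I α β) hperm [] hD hl α β
    rw [List.nil_append, List.nil_append] at h0
    rw [h0, Hecke.yWord_append, Hecke.yWord_replicate, hOp_mul]
    have h1 := hq (Yangian.t (α m₁) (β m₁) d) _ (ih (I.erase m₁) (by omega) l'' hl'' α β)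
    rw [hπ, sumOp, LinearMap.sum_apply, ← Submodule.mkQ_apply, map_sum,
      ← Finset.sum_add_sum_compl (I.erase m₁)] at h1
    simp only [LinearMap.comp_apply, Submodule.mkQ_apply] at h1
    rw [Finset.sum_congr rfl (s₁ := (I.erase m₁)ᶜ) fun m hm => mk_term_eq hf
      (Finset.mem_compl.1 hm) (Finset.notMem_erase m₁ I) hl'' d _ _ α β, Finset.sum_const,
      ← Nat.cast_smul_eq_nsmul ℂ] at h1
    have h2 := (q.add_mem_iff_right (q.sum_mem fun m hm => ?_)).1 h1
    · have h3 : (((I.erase m₁)ᶜ.card : ℕ) : ℂ) ≠ 0 := by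
        rw [Nat.cast_ne_zero, Finset.card_ne_zero]
        exact ⟨m₁, Finset.mem_compl.2 (Finset.notMem_erase m₁ I)⟩
      rw [q.smul_mem_iff h3, tauOp_hOp, tauOp_matrixUnitOp_of_notMem (Finset.notMem_erase m₁ I),
        Finset.insert_erase hm₁] at h2
      exact h2
    · rw [tauOp_hOp, tauOp_matrixUnitOp_of_mem hm]
      split_ifs
      · rw [← hOp_mul, ← Hecke.yWord_replicate, ← Hecke.yWord_append]
        refine ih _ (by omega) _ (fun i hi => ?_) _ _
        rw [List.mem_append, List.mem_replicate] at hi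
        rcases hi with hi | hi
        · rwa [hi.2]
        · exact hl'' i hi
      · rw [map_zero, map_zero, Submodule.Quotient.mk_zero]
        exact q.zero_mem

/-- The Drinfeld functor sends simple modules to simple modules or zero. -/
theorem eq_bot_or_eq_top_of_yStable (hρ : HSimple ρ) (hπ : IsDrinfeldAction n ρ π)
    (hq : YStable π q) : q = ⊥ ∨ q = ⊤ := by
  by_cases hq0 : q = ⊥
  · exact Or.inl hq0
  right
  obtain ⟨x, hx, hx0⟩ := q.exists_mem_ne_zero_of_ne_bot hq0
  obtain ⟨g, rfl⟩ := Submodule.Quotient.mk_surjective _ x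
  have hcard : (Fintype.card (Equiv.Perm (Fin ℓ)) : ℂ) ≠ 0 :=
    Nat.cast_ne_zero.2 Fintype.card_ne_zero
  have hf := fun σ => twist_antisymmetrize (ρ := ρ) σ g
  have hfq : Submodule.Quotient.mk (antisymmetrize n ρ g) ∈ q := by
    rw [mk_antisymmetrize]
    exact q.smul_mem _ hx
  have hf0 : antisymmetrize n ρ g ≠ 0 := by
    intro h
    have := mk_antisymmetrize (ρ := ρ) g
    rw [h, Submodule.Quotient.mk_zero] at this
    exact smul_ne_zero hcard hx0 this.symm
  generalize antisymmetrize n ρ g = f at hf hfq hf0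
  obtain ⟨β₀, hβ₀⟩ := Function.ne_iff.1 hf0
  have hmem := fun l α β => mk_yWord_matrixUnitOp_mem hπ hq hf hfq _ Finset.univ rfl l
    (fun _ _ => Finset.mem_univ _) α β
  simp only [matrixUnitOp_univ] at hmem
  set p : Submodule ℂ M := Submodule.span ℂ
    (Set.range fun x : List (Fin ℓ) × Word ℓ n => ρ (Hecke.yWord x.1) (f x.2)) with hp
  have hpmem : ∀ l β, ρ (Hecke.yWord l) (f β) ∈ p := fun l β => Submodule.subset_span ⟨(l, β), rfl⟩
  have hptop : p = ⊤ := by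
    refine (hρ.2 p (Hecke.hStable_of_sigma_of_y (fun w x hx => ?_) fun m x hx => ?_)).resolve_left ?_
    · induction hx using Submodule.span_induction with
      | mem x hx =>
        obtain ⟨⟨l, β⟩, rfl⟩ := hx
        simp only
        rw [← Module.End.mul_apply, ← map_mul, Hecke.sigma_mul_yWord, map_mul,
          Module.End.mul_apply, rho_sigma_apply_of_twist hf, map_smul]
        exact p.smul_mem _ (hpmem _ _)
      | zero => simp
      | add x y _ _ hx hy => simpa using p.add_mem hx hy
      | smul c x _ hx => simpa using p.smul_mem c hx
    · induction hx using Submodule.span_induction with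
      | mem x hx =>
        obtain ⟨⟨l, β⟩, rfl⟩ := hx
        simp only
        rw [← Module.End.mul_apply, ← map_mul, ← Hecke.yWord_cons]
        exact hpmem _ _
      | zero => simp
      | add x y _ _ hx hy => simpa using p.add_mem hx hy
      | smul c x _ hx => simpa using p.smul_mem c hx
    · intro h
      have := hpmem [] β₀
      rw [h, Submodule.mem_bot] at this
      exact hβ₀ (by simpa [Hecke.yWord] using this)
  have hsingle : ∀ (α : Word ℓ n) (x : M), Submodule.Quotient.mk (Pi.single α x) ∈ q := by
    intro α x
    have hx : x ∈ p := hptop ▸ Submodule.mem_top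
    induction hx using Submodule.span_induction with
    | mem x hx =>
      obtain ⟨⟨l, β⟩, rfl⟩ := hx
      have h1 : hOp n ρ (Hecke.yWord l) (Pi.single α (f β)) =
          Pi.single α (ρ (Hecke.yWord l) (f β)) := by
        funext w
        rw [hOp_apply]
        exact Pi.apply_single (fun _ => ρ (Hecke.yWord l)) (fun _ => map_zero _) α (f β) w
      exact h1 ▸ hmem l α β
    | zero => rw [Pi.single_zero, Submodule.Quotient.mk_zero]; exact q.zero_mem
    | add x y _ _ hx hy =>
      rw [Pi.single_add, Submodule.Quotient.mk_add]
      exact q.add_mem hx hy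
    | smul c x _ hx =>
      rw [Pi.single_smul, Submodule.Quotient.mk_smul]
      exact q.smul_mem c hx
  rw [eq_top_iff]
  rintro x -
  obtain ⟨g, rfl⟩ := Submodule.Quotient.mk_surjective _ x
  rw [← Finset.univ_sum_single g, ← Submodule.mkQ_apply, map_sum]
  exact q.sum_mem fun w _ => hsingle w _

end matrixUnit

section Functoriality

variable {ℓ n : ℕ} {M M' : Type} [AddCommGroup M] [Module ℂ M] [AddCommGroup M'] [Module ℂ M']
  {ρ : Hecke ℓ →ₐ[ℂ] Module.End ℂ M} {ρ' : Hecke ℓ →ₐ[ℂ] Module.End ℂ M'} {φ : M →ₗ[ℂ] M'}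

lemma compLeft_sOp (hφ : ∀ h x, φ (ρ h x) = ρ' h (φ x)) (i j : Fin ℓ) (f : MW ℓ n M) :
    φ.compLeft (Word ℓ n) (sOp n ρ i j f) = sOp n ρ' i j (φ.compLeft (Word ℓ n) f) :=
  funext fun _ => hφ _ _

lemma compLeft_sumOp (hφ : ∀ h x, φ (ρ h x) = ρ' h (φ x)) (a b : Fin n) (d : ℕ)
    (f : MW ℓ n M) :
    φ.compLeft (Word ℓ n) (sumOp n ρ a b d f) = sumOp n ρ' a b d (φ.compLeft (Word ℓ n) f) := by
  rw [sumOp, sumOp, LinearMap.sum_apply, LinearMap.sum_apply, map_sum]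
  refine Finset.sum_congr rfl fun m _ => funext fun w => ?_
  refine (hφ _ _).trans (congrArg _ ?_)
  rw [tauOp_apply, tauOp_apply, apply_ite φ, map_zero]
  rfl

lemma NSub_le_comap (hφ : ∀ h x, φ (ρ h x) = ρ' h (φ x)) :
    NSub n ρ ≤ (NSub n ρ').comap (φ.compLeft (Word ℓ n)) := by
  refine iSup_le fun i => iSup_le fun h => ?_
  rintro _ ⟨f, rfl⟩
  rw [Submodule.mem_comap, LinearMap.add_apply, map_add, compLeft_sOp hφ]
  exact Submodule.mem_iSup_of_mem i
    (Submodule.mem_iSup_of_mem h ⟨φ.compLeft (Word ℓ n) f, rfl⟩)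

/-- The map `D_ℓ(φ) : D_ℓ(M) → D_ℓ(M')` induced by an `H_ℓ`-equivariant map `φ`. -/
def dmodMap (n : ℕ) (hφ : ∀ h x, φ (ρ h x) = ρ' h (φ x)) : Dmod n ρ →ₗ[ℂ] Dmod n ρ' :=
  Submodule.mapQ _ _ (φ.compLeft (Word ℓ n)) (NSub_le_comap hφ)

lemma dmodMap_mk (hφ : ∀ h x, φ (ρ h x) = ρ' h (φ x)) (f : MW ℓ n M) :
    dmodMap n hφ (Submodule.Quotient.mk f) = Submodule.Quotient.mk (φ.compLeft (Word ℓ n) f) :=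
  rfl

lemma dmodMap_surjective (hφ : ∀ h x, φ (ρ h x) = ρ' h (φ x)) (hsurj : Function.Surjective φ) :
    Function.Surjective (dmodMap n hφ) := by
  intro x
  obtain ⟨f, rfl⟩ := Submodule.Quotient.mk_surjective _ x
  refine ⟨Submodule.Quotient.mk fun w => Function.surjInv hsurj (f w), ?_⟩
  rw [dmodMap_mk]
  exact congrArg _ (funext fun w => Function.surjInv_eq hsurj (f w))

lemma dmodMap_equivariant (hφ : ∀ h x, φ (ρ h x) = ρ' h (φ x))
    {π : Yangian n →ₐ[ℂ] Module.End ℂ (Dmod n ρ)} {π' : Yangian n →ₐ[ℂ] Module.End ℂ (Dmod n ρ')}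
    (hπ : IsDrinfeldAction n ρ π) (hπ' : IsDrinfeldAction n ρ' π') (y : Yangian n)
    (x : Dmod n ρ) : dmodMap n hφ (π y x) = π' y (dmodMap n hφ x) := by
  refine Yangian.equivariant_of_t (fun a b d x => ?_) y x
  obtain ⟨f, rfl⟩ := Submodule.Quotient.mk_surjective _ x
  rw [hπ, dmodMap_mk, dmodMap_mk, hπ', compLeft_sumOp hφ]

end Functoriality

lemma quotient_mk_one_ne_zero {ℓ : ℕ} {I : Submodule (Hecke ℓ) (Hecke ℓ)} {M : Type}
    [AddCommGroup M] [Module ℂ M] [Nontrivial M] {ρ : Hecke ℓ →ₐ[ℂ] Module.End ℂ M}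
    {φ : (Hecke ℓ ⧸ I) →ₗ[ℂ] M} (hφ : ∀ h x, φ (quotRho I h x) = ρ h (φ x))
    (hsurj : Function.Surjective φ) : φ (Submodule.Quotient.mk 1) ≠ 0 := by
  intro h0
  obtain ⟨x, hx⟩ := exists_ne (0 : M)
  obtain ⟨z, rfl⟩ := hsurj x
  obtain ⟨h, rfl⟩ := Submodule.Quotient.mk_surjective _ z
  refine hx ?_
  have h1 : (Submodule.Quotient.mk h : Hecke ℓ ⧸ I) = quotRho I h (Submodule.Quotient.mk 1) := by
    change _ = h • (Submodule.Quotient.mk 1 : Hecke ℓ ⧸ I)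
    rw [← Submodule.Quotient.mk_smul, smul_eq_mul, mul_one]
  rw [h1, hφ, h0, map_zero]

/-- For dominant weights, `D_ℓ` does not kill a module with a standard vector whose row lengths
are at most `n`. -/
lemma IsStandardVector.nontrivial_dmod {n r ℓ : ℕ} {L : Fin r → ℕ} {lam μ : Fin r → ℂ} {M : Type}
    [AddCommGroup M] [Module ℂ M] {ρ : Hecke ℓ →ₐ[ℂ] Module.End ℂ M}
    {Λ : CellLabelling (Fin ℓ) r (extendZero L)} (hΛ : Λ.IsStandard) {u : M}
    (hu : IsStandardVector μ ρ Λ u) (hu0 : u ≠ 0)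
    (hdom : ∀ i j : Fin r, i < j → ∀ m : ℕ, lam i - lam j ≠ -((m : ℂ) + 1))
    (hlam : ∀ i, lam i - μ i = (L i : ℂ)) (hL : ∀ i, L i ≤ n) : Nontrivial (Dmod n ρ) := by
  have hcol : ∀ m, Λ.col m < n := fun m => by
    refine (Λ.col_lt m).trans_le ?_
    have := extendZero_val L ⟨Λ.row m, Λ.row_lt m⟩
    dsimp only at this
    rw [this]
    exact hL _
  have hdom' : ∀ i j, i < j → j < r → ∀ N : ℕ,
      (extendZero μ i + ((extendZero L i : ℕ) : ℂ)) -
        (extendZero μ j + ((extendZero L j : ℕ) : ℂ)) ≠ -((N : ℂ) + 1) := by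
    intro i j hij hj N
    have hi := hij.trans hj
    have h1 := extendZero_val L ⟨i, hi⟩
    have h2 := extendZero_val L ⟨j, hj⟩
    have h3 := extendZero_val μ ⟨i, hi⟩
    have h4 := extendZero_val μ ⟨j, hj⟩
    dsimp only at h1 h2 h3 h4
    rw [h1, h2, h3, h4, ← hlam, ← hlam, add_sub_cancel, add_sub_cancel]
    exact hdom ⟨i, hi⟩ ⟨j, hj⟩ hij N
  obtain ⟨v, hv, hanti⟩ := EquivariantAction.exists_column_antisymmetric
    (T := Hecke.toEquivariantAction ρ) (Λ := Λ) (μ := extendZero μ) hdom' hu0 hu.symm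
    (hu.eta_apply hΛ)
  exact _root_.nontrivial_dmod (col := fun m => (⟨Λ.col m, hcol m⟩ : Fin n)) hv
    fun a b hab h => hanti a b hab (congrArg Fin.val h)

/-- Let `λ ∈ ℂ^r` be dominant, `μ ∈ S(λ;ℓ)`, and `L` a simple quotient
of the `H_ℓ`-module `K(λ,μ)`. If `μ ∈ S^{(n)}(λ;ℓ)` then `D_ℓ(L)` is a nonzero simple
`Y(gl_n)`-module and the quotient map induces a surjection of `Y(gl_n)`-modules
`D_ℓ(K(λ,μ)) ↠ D_ℓ(L)`; if `μ ∉ S^{(n)}(λ;ℓ)` then `D_ℓ(L) = 0`. -/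
theorem statement3 (n ℓ r : ℕ) (hn : 0 < n) (hℓ : 0 < ℓ) (hr : 0 < r)
    (lam μ : Fin r → ℂ) (L : Fin r → ℕ)
    (hdom : ∀ i j : Fin r, i < j → ∀ m : ℕ, lam i - lam j ≠ -((m : ℂ) + 1))
    (hSmem : ∀ i, lam i - μ i = (L i : ℂ))
    (hSsum : ∑ i, L i = ℓ)
    (Lm : Type) [AddCommGroup Lm] [Module ℂ Lm]
    (ρL : Hecke ℓ →ₐ[ℂ] Module.End ℂ Lm)
    (φ : KMod ℓ L μ →ₗ[ℂ] Lm)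
    (hequiv : ∀ (h : Hecke ℓ) (x : KMod ℓ L μ), φ (quotRho (KIdeal ℓ L μ) h x) = ρL h (φ x))
    (hsurj : Function.Surjective φ)
    (hLsimple : HSimple ρL)
    (πK : Yangian n →ₐ[ℂ] Module.End ℂ (Dmod n (quotRho (KIdeal ℓ L μ))))
    (hπK : IsDrinfeldAction n (quotRho (KIdeal ℓ L μ)) πK)
    (πL : Yangian n →ₐ[ℂ] Module.End ℂ (Dmod n ρL))
    (hπL : IsDrinfeldAction n ρL πL) :
    ((∀ i, L i ≤ n) →
      Nontrivial (Dmod n ρL) ∧ YSimple πL ∧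
      ∃ Φ : Dmod n (quotRho (KIdeal ℓ L μ)) →ₗ[ℂ] Dmod n ρL,
        (∀ f : MW ℓ n (KMod ℓ L μ),
          Φ (Submodule.Quotient.mk f) = Submodule.Quotient.mk (φ.compLeft (Word ℓ n) f)) ∧
        Function.Surjective Φ ∧
        (∀ (y : Yangian n) (x : Dmod n (quotRho (KIdeal ℓ L μ))),
          Φ (πK y x) = πL y (Φ x))) ∧
    ((∃ i, n < L i) → Subsingleton (Dmod n ρL)) := by
  obtain ⟨Λ, hΛ⟩ := exists_cellLabelling hSsum
  have := hLsimple.1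
  have hu := isStandardVector_of_quotient hequiv hΛ
  have hu0 := quotient_mk_one_ne_zero hequiv hsurj
  refine ⟨fun hLn => ?_, fun ⟨_, hk⟩ => hu.subsingleton_dmod hLsimple hu0 hk⟩
  have hnt : Nontrivial (Dmod n ρL) := hu.nontrivial_dmod hΛ hu0 hdom hSmem hLn
  exact ⟨hnt, ⟨hnt, fun _ hq => eq_bot_or_eq_top_of_yStable hLsimple hπL hq⟩,
    dmodMap n hequiv, dmodMap_mk hequiv, dmodMap_surjective hequiv hsurj,
    dmodMap_equivariant hequiv hπK hπL⟩
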